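/- arXiv:1902.08406 — 2 statements merged into one kernel-verified Lean document; each statement's English description precedes it below -/
import Mathlib

section
/- Let A* be an (r−1)-connected (r > 1) Poincaré DGCA of degree n of Hodge type whose harmonic subspace H* is adapted to a generating subspace. Then A* is equivalent to the small quotient algebra Q*_small, which is a finite-dimensional nondegenerate Poincaré DGCA of degree n of Hodge type (the inclusion A*_small ↪ A* and the projection A*_small → Q*_small are quasi-isomorphisms), and Q^k_small equals its harmonic subspace (the image of H^k under the projection) for 0 ≤ k ≤ 2r−2 and for n−2r+2 ≤ k ≤ n. If moreover the multiplication map H^r(A*) ⊙ H^r(A*) → H^{2r}(A*) (on symmetric 2-tensors of cohomology) is injective, then the same holds also for k = 2r−1 and k = n−2r+1. -/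
universe u v

open scoped TensorProduct

/-- A (not necessarily commutative) differential graded algebra over `F`:
a nonnegatively graded, associative, unital `F`-algebra equipped with a degree `+1`
differential `d` satisfying `d ∘ d = 0` and the graded Leibniz rule. -/
structure DGA (F : Type u) (A : Type v) [Field F] [Ring A] [Algebra F A] where
  grading : ℤ → Submodule F A
  internal : DirectSum.IsInternal grading
  nonneg : ∀ i : ℤ, i < 0 → grading i = ⊥
  one_mem : (1 : A) ∈ grading 0
  mul_mem : ∀ {i j : ℤ} {a b : A}, a ∈ grading i → b ∈ grading j → a * b ∈ grading (i + j)
  d : A →ₗ[F] A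
  d_mem : ∀ {i : ℤ} {a : A}, a ∈ grading i → d a ∈ grading (i + 1)
  d_d : ∀ a : A, d (d a) = 0
  leibniz : ∀ {i : ℤ} (a b : A), a ∈ grading i →
    d (a * b) = d a * b + ((-1 : F) ^ i) • (a * d b)

namespace DGA

variable {F : Type u} {A : Type v} [Field F] [Ring A] [Algebra F A]

/-- The cocycles of degree `k`. -/
def Zc (D : DGA F A) (k : ℤ) : Submodule F A := D.grading k ⊓ LinearMap.ker D.d

/-- The coboundaries of degree `k`. -/
def Bc (D : DGA F A) (k : ℤ) : Submodule F A := Submodule.map D.d (D.grading (k - 1))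

/-- `a` is exact, i.e. a coboundary. -/
def IsExact (D : DGA F A) (a : A) : Prop := ∃ b, a = D.d b

/-- Two elements define the same cohomology class. -/
def Cohomologous (D : DGA F A) (a b : A) : Prop := ∃ c, a - b = D.d c

/-- `H^0 = F·[1]`. -/
def Connected (D : DGA F A) : Prop :=
  ∀ a ∈ D.grading 0, D.d a = 0 → ∃ c : F, a = c • (1 : A)

/-- Connected and `H^k = 0` for `1 ≤ k ≤ r`.  An `(r-1)`-connected DGA in the sense of
the paper is one satisfying `RConnected (r-1)`. -/
def RConnected (D : DGA F A) (r : ℤ) : Prop :=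
  D.Connected ∧ ∀ k : ℤ, 1 ≤ k → k ≤ r → ∀ a ∈ D.grading k, D.d a = 0 → D.IsExact a

/-- A harmonic subspace: a graded complement of the coboundaries inside the cocycles. -/
def IsHarmonicFamily (D : DGA F A) (H : ℤ → Submodule F A) : Prop :=
  ∀ k : ℤ, H k ≤ D.Zc k ∧ Disjoint (D.Bc k) (H k) ∧ D.Zc k ≤ D.Bc k ⊔ H k

/-- The operator `d⁻` attached to a decomposition `A = dA ⊕ H ⊕ B`: the inverse of
`d : B → dA` extended by `0` on `H ⊕ B`. -/
def IsDminus (D : DGA F A) (H B : ℤ → Submodule F A) (dm : A →ₗ[F] A) : Prop :=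
  (∀ k : ℤ, ∀ b ∈ B k, dm (D.d b) = b) ∧
  (∀ k : ℤ, ∀ h ∈ H k, dm h = 0) ∧
  (∀ k : ℤ, ∀ b ∈ B k, dm b = 0) ∧
  (∀ k : ℤ, ∀ a ∈ D.grading k, dm a ∈ B (k - 1))

/-- The projection `π_H : A → H` with kernel `dA ⊕ B`. -/
def IsHarmonicProj (D : DGA F A) (H B : ℤ → Submodule F A) (pH : A →ₗ[F] A) : Prop :=
  (∀ k : ℤ, ∀ h ∈ H k, pH h = h) ∧
  (∀ k : ℤ, ∀ b ∈ B k, pH b = 0) ∧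
  (∀ a : A, pH (D.d a) = 0) ∧
  (∀ k : ℤ, ∀ a ∈ D.grading k, pH a ∈ H k)

/-- The degree of the entry `a i j` of a defining system: `|x_i| + ⋯ + |x_j| - (j - i)`. -/
def degSum (deg : ℕ → ℤ) (i j : ℕ) : ℤ :=
  (∑ t ∈ Finset.Icc i j, deg t) - ((j - i : ℕ) : ℤ)

/-- A defining system for the `l`-th order Massey product of the classes of the
cocycles `x 1, …, x l` (of degrees `deg 1, …, deg l`). -/
def IsDefiningSystem (D : DGA F A) (l : ℕ) (deg : ℕ → ℤ) (x : ℕ → A)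
    (a : ℕ → ℕ → A) : Prop :=
  (∀ i : ℕ, 1 ≤ i → i ≤ l →
      a i i ∈ D.grading (deg i) ∧ D.d (a i i) = 0 ∧ D.Cohomologous (a i i) (x i)) ∧
  (∀ i j : ℕ, 1 ≤ i → i ≤ j → j ≤ l → a i j ∈ D.grading (degSum deg i j)) ∧
  (∀ i j : ℕ, 1 ≤ i → i < j → j ≤ l → ¬(i = 1 ∧ j = l) →
    D.d (a i j) = ∑ k ∈ Finset.Ico i j, ((-1 : F) ^ degSum deg i k) • (a i k * a (k + 1) j))

/-- The cocycle `∑ ā_{1k} a_{k+1,l}` produced by a defining system. -/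
def masseyOut (D : DGA F A) (l : ℕ) (deg : ℕ → ℤ) (a : ℕ → ℕ → A) : A :=
  ∑ k ∈ Finset.Ico 1 l, ((-1 : F) ^ degSum deg 1 k) • (a 1 k * a (k + 1) l)

/-- `(x 1, …, x l)` is a Massey `l`-tuple: the Massey product is nonempty. -/
def IsMasseyTuple (D : DGA F A) (l : ℕ) (deg : ℕ → ℤ) (x : ℕ → A) : Prop :=
  (∀ i : ℕ, 1 ≤ i → i ≤ l → x i ∈ D.Zc (deg i)) ∧ ∃ a, D.IsDefiningSystem l deg x a

/-- The `l`-th order Massey product of `(x 1, …, x l)` is trivial: it contains `0`. -/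
def MasseyTrivial (D : DGA F A) (l : ℕ) (deg : ℕ → ℤ) (x : ℕ → A) : Prop :=
  ∃ a, D.IsDefiningSystem l deg x a ∧ D.IsExact (D.masseyOut l deg a)

end DGA

/-- A differential graded commutative algebra (DGCA) over `F`. -/
structure DGCA (F : Type u) (A : Type v) [Field F] [Ring A] [Algebra F A]
    extends DGA F A where
  gcomm : ∀ {i j : ℤ} (a b : A), a ∈ grading i → b ∈ grading j →
    a * b = ((-1 : F) ^ (i * j)) • (b * a)

/-- A Poincaré DGCA of degree `n`: a DGCA concentrated in degrees `0, …, n`, with finite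
dimensional cohomology, equipped with a linear functional `∫` (given here as `intg`, a
functional on `A` vanishing in degrees `≠ n` and on coboundaries) such that the induced
pairing `⟨a, b⟩ = ∫ [a * b]` is nondegenerate on cohomology. -/
structure PoincareDGCA (F : Type u) (A : Type v) [Field F] [Ring A] [Algebra F A]
    (n : ℤ) extends DGCA F A where
  top : ∀ i : ℤ, n < i → grading i = ⊥
  fin_cohomology : ∀ k : ℤ, ∃ W : Submodule F A, FiniteDimensional F W ∧
    ∀ a ∈ grading k, d a = 0 → ∃ w ∈ W, ∃ c, a - w = d c
  intg : A →ₗ[F] F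
  intg_deg : ∀ i : ℤ, i ≠ n → ∀ a ∈ grading i, intg a = 0
  intg_d : ∀ a : A, intg (d a) = 0
  nondeg : ∀ i : ℤ, ∀ a ∈ grading i, d a = 0 →
    (∀ b ∈ grading (n - i), d b = 0 → intg (a * b) = 0) → ∃ c, a = d c

namespace PoincareDGCA

variable {F : Type u} {A : Type v} [Field F] [Ring A] [Algebra F A] {n : ℤ}

/-- The null space `A⊥` of the induced pairing `⟨a, b⟩ = ∫ (a * b)` on `A`. -/
def perp (P : PoincareDGCA F A n) : Submodule F A :=
  ⨅ b : A, LinearMap.ker (P.intg ∘ₗ LinearMap.mulRight F b)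

/-- `A = dA ⊕ H ⊕ B` is a Hodge type decomposition: `H` is a harmonic subspace,
`B` is a graded complement, and `⟨H ⊕ B, B⟩ = 0`. -/
def IsHodge (P : PoincareDGCA F A n) (H B : ℤ → Submodule F A) : Prop :=
  P.toDGA.IsHarmonicFamily H ∧
  (∀ k : ℤ, B k ≤ P.grading k) ∧
  (∀ k : ℤ, Disjoint (P.toDGA.Bc k ⊔ H k) (B k)) ∧
  (∀ k : ℤ, P.grading k ≤ P.toDGA.Bc k ⊔ H k ⊔ B k) ∧
  (∀ j k : ℤ, ∀ a ∈ H j ⊔ B j, ∀ b ∈ B k, P.intg (a * b) = 0)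

/-- A Poincaré DGCA of Hodge type: one admitting a Hodge type decomposition. -/
def HodgeType (P : PoincareDGCA F A n) : Prop := ∃ H B, P.IsHodge H B

end PoincareDGCA

/-- A bundled DGCA over `F`. -/
structure BDGCA (F : Type u) [Field F] : Type (max (u + 1) (v + 1)) where
  carrier : Type v
  [ringInst : Ring carrier]
  [algInst : Algebra F carrier]
  str : DGCA F carrier

attribute [instance] BDGCA.ringInst BDGCA.algInst

/-- A morphism of DGCAs: an algebra homomorphism preserving the grading and
commuting with the differentials. -/
structure DGCAHom {F : Type u} [Field F] (X Y : BDGCA.{u, v} F) where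
  f : X.carrier →ₐ[F] Y.carrier
  map_grading : ∀ i : ℤ, ∀ a ∈ X.str.grading i, f a ∈ Y.str.grading i
  map_d : ∀ a, f (X.str.d a) = Y.str.d (f a)

/-- A quasi-isomorphism: a DGCA morphism inducing an isomorphism on cohomology. -/
def DGCAHom.QuasiIso {F : Type u} [Field F] {X Y : BDGCA.{u, v} F}
    (φ : DGCAHom X Y) : Prop :=
  (∀ i : ℤ, ∀ a ∈ X.str.grading i, X.str.d a = 0 →
    (∃ b, φ.f a = Y.str.d b) → ∃ c, a = X.str.d c) ∧
  (∀ i : ℤ, ∀ a' ∈ Y.str.grading i, Y.str.d a' = 0 →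
    ∃ a ∈ X.str.grading i, X.str.d a = 0 ∧ ∃ b, φ.f a - a' = Y.str.d b)

/-- Two DGCAs are equivalent if they are joined by a finite zig-zag of
quasi-isomorphisms. -/
def DGCAEquivalent {F : Type u} [Field F] : BDGCA.{u, v} F → BDGCA.{u, v} F → Prop :=
  Relation.EqvGen fun X Y => ∃ φ : DGCAHom X Y, φ.QuasiIso

/-- A DGCA is formal if it is equivalent to a DGCA with zero differential
(equivalently, to its cohomology with the zero differential). -/
def DGCAFormal {F : Type u} [Field F] (X : BDGCA.{u, v} F) : Prop :=
  ∃ Y : BDGCA.{u, v} F, Y.str.d = 0 ∧ DGCAEquivalent X Y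

variable {F : Type u} {A : Type v} [Field F] [Ring A] [Algebra F A]

/-- An `H*`-subalgebra: a differential graded subalgebra of `A*` containing the
harmonic subspace `H` and invariant under `d` and `d⁻`. -/
def IsHSubalgebra (D : DGA F A) (H : ℤ → Submodule F A) (dm : A →ₗ[F] A)
    (C : Subalgebra F A) : Prop :=
  (∀ k : ℤ, H k ≤ Subalgebra.toSubmodule C) ∧
  (∀ a ∈ C, D.d a ∈ C) ∧ (∀ a ∈ C, dm a ∈ C)

/-- The small algebra `A*_small`: the smallest `H*`-subalgebra of `A*`. -/
def smallAlgebra (D : DGA F A) (H : ℤ → Submodule F A) (dm : A →ₗ[F] A) :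
    Subalgebra F A :=
  sInf {C : Subalgebra F A | IsHSubalgebra D H dm C}

/-- The span, in degree `k`, of products of two positive-degree cocycles. -/
def posProdSpan (D : DGA F A) (k : ℤ) : Submodule F A :=
  Submodule.span F {x : A | ∃ i j : ℤ, 1 ≤ i ∧ 1 ≤ j ∧ i + j = k ∧
    ∃ a ∈ D.Zc i, ∃ b ∈ D.Zc j, x = a * b}

/-- A graded family `G` of cocycles representing a generating subspace
`H*_gen ⊆ H*₊` together with a partial splitting map `ι₀`. -/
def IsGeneratingFamily (D : DGA F A) (G : ℤ → Submodule F A) : Prop :=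
  (∀ k : ℤ, G k ≤ D.Zc k) ∧
  (∀ k : ℤ, k ≤ 0 → G k = ⊥) ∧
  (∀ k : ℤ, Disjoint (G k) (posProdSpan D k ⊔ D.Bc k)) ∧
  (∀ k : ℤ, 1 ≤ k → D.Zc k ≤ G k ⊔ posProdSpan D k ⊔ D.Bc k)

/-- The harmonic subspace `H'` is adapted to the generating subspace encoded by `G`. -/
def IsAdaptedHarmonic (D : DGA F A) (G H' : ℤ → Submodule F A) : Prop :=
  D.IsHarmonicFamily H' ∧ (∀ k : ℤ, G k ≤ H' k) ∧
  (∀ k : ℤ, H' k ≤ Subalgebra.toSubmodule (Algebra.adjoin F {a : A | ∃ j : ℤ, a ∈ G j}))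

/-- The multiplication map `M ⊗ M → A` of a subspace `M ⊆ A`. -/
noncomputable def mulTensor (M : Submodule F A) : (M ⊗[F] M) →ₗ[F] A :=
  TensorProduct.lift (((LinearMap.mul F A).comp M.subtype).compl₂ M.subtype)

/-- The graded flip `x ⊗ y ↦ (-1)^{r·r} y ⊗ x` on `M ⊗ M` for `M` of degree `r`;
its fixed points are the graded-symmetric `2`-tensors `M ⊙ M`. -/
noncomputable def gradedFlip (r : ℤ) (M : Submodule F A) : (M ⊗[F] M) →ₗ[F] (M ⊗[F] M) :=
  ((-1 : F) ^ (r * r)) • (TensorProduct.comm F M M).toLinearMap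

section LinearAlgebra

theorem LinearMap.exists_factor_of_ker_le {K V W U : Type*} [Field K] [AddCommGroup V]
    [Module K V] [AddCommGroup W] [Module K W] [AddCommGroup U] [Module K U]
    (f : V →ₗ[K] W) (hf : Function.Surjective f) (g : V →ₗ[K] U)
    (h : ∀ v, f v = 0 → g v = 0) : ∃ g' : W →ₗ[K] U, ∀ v, g' (f v) = g v := by
  obtain ⟨s, hs⟩ := f.exists_rightInverse_of_surjective (LinearMap.range_eq_top.2 hf)
  refine ⟨g ∘ₗ s, fun v => ?_⟩
  have : f (s (f v) - v) = 0 := by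
    rw [map_sub, sub_eq_zero]
    exact LinearMap.congr_fun hs (f v)
  have := h _ this
  rwa [map_sub, sub_eq_zero] at this

end LinearAlgebra

namespace DGA

theorem iSup_grading (D : DGA F A) : ⨆ k, D.grading k = ⊤ :=
  D.internal.submodule_iSup_eq_top

theorem homogeneous_induction (D : DGA F A) {p : A → Prop}
    (hom : ∀ i, ∀ a ∈ D.grading i, p a) (hadd : ∀ a b, p a → p b → p (a + b)) (a : A) : p a :=
  Submodule.iSup_induction D.grading (motive := p) (D.iSup_grading ▸ Submodule.mem_top : a ∈ _)
    hom (hom 0 0 (zero_mem _)) hadd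

theorem d_one (D : DGA F A) : D.d 1 = 0 := by
  have h := D.leibniz 1 1 D.one_mem
  simpa using h

theorem one_mem_Zc (D : DGA F A) : (1 : A) ∈ D.Zc 0 := ⟨D.one_mem, D.d_one⟩

theorem Bc_zero (D : DGA F A) : D.Bc 0 = ⊥ := by
  rw [Bc, D.nonneg (0 - 1) (by norm_num), Submodule.map_bot]

/-- A family of homogeneous subspaces is recovered from its sum by taking degree parts. -/
theorem mem_of_mem_iSup (D : DGA F A) {N : ℤ → Submodule F A} (hN : ∀ k, N k ≤ D.grading k)
    {k : ℤ} {a : A} (ha : a ∈ D.grading k) (ha' : a ∈ ⨆ j, N j) : a ∈ N k := by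
  have hle : ⨆ j, N j ≤ N k ⊔ ⨆ (j) (_ : j ≠ k), D.grading j := by
    refine iSup_le fun j => ?_
    by_cases hj : j = k
    · subst hj; exact le_sup_left
    · exact ((hN j).trans (le_iSup₂_of_le j hj le_rfl)).trans le_sup_right
  obtain ⟨y, hy, z, hz, rfl⟩ := Submodule.mem_sup.1 (hle ha')
  have hz' : z ∈ D.grading k := by simpa using sub_mem ha (hN k hy)
  have : z = 0 := Submodule.disjoint_def.1 (D.internal.submodule_iSupIndep k) z hz' hz
  simpa [this] using hy

theorem IsDminus.dm_dm {D : DGA F A} {H B : ℤ → Submodule F A} {dm : A →ₗ[F] A}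
    (hdm : D.IsDminus H B dm) (a : A) : dm (dm a) = 0 := by
  revert a
  refine D.homogeneous_induction (fun k a ha => ?_) fun a b h h' => ?_
  · exact hdm.2.2.1 _ _ (hdm.2.2.2 k a ha)
  · rw [map_add, map_add, h, h', add_zero]

end DGA

namespace PoincareDGCA

variable {n : ℤ}

theorem intg_mul_eq_zero (P : PoincareDGCA F A n) {i j : ℤ} {a b : A} (ha : a ∈ P.grading i)
    (hb : b ∈ P.grading j) (hij : i + j ≠ n) : P.intg (a * b) = 0 :=
  P.intg_deg _ hij _ (P.mul_mem ha hb)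

theorem exists_intg_mul_comm (P : PoincareDGCA F A n) {i : ℤ} {a : A} (ha : a ∈ P.grading i) :
    ∃ c : F, ∀ b, P.intg (a * b) = c * P.intg (b * a) := by
  refine ⟨(-1) ^ (i * (n - i)), P.homogeneous_induction (fun j b hb => ?_) fun b b' h h' => ?_⟩
  · by_cases hij : i + j = n
    · obtain rfl : j = n - i := by omega
      rw [P.gcomm a b ha hb, map_smul, smul_eq_mul]
    · rw [P.intg_mul_eq_zero ha hb hij, P.intg_mul_eq_zero hb ha (by omega), mul_zero]
  · rw [mul_add, add_mul, map_add, map_add, h, h', mul_add]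

theorem intg_mul_eq_zero_symm (P : PoincareDGCA F A n) {i : ℤ} {a b : A} (ha : a ∈ P.grading i)
    (h : P.intg (b * a) = 0) : P.intg (a * b) = 0 := by
  obtain ⟨c, hc⟩ := P.exists_intg_mul_comm ha
  rw [hc, h, mul_zero]

theorem intg_d_mul_of_mem (P : PoincareDGCA F A n) {i : ℤ} {a : A} (ha : a ∈ P.grading i)
    (b : A) : P.intg (P.d a * b) = -((-1) ^ i * P.intg (a * P.d b)) := by
  have h := P.intg_d (a * b)
  rw [P.leibniz a b ha, map_add, map_smul, smul_eq_mul] at h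
  exact eq_neg_of_add_eq_zero_left h

theorem exists_intg_d_mul (P : PoincareDGCA F A n) {j : ℤ} {t : A} (ht : t ∈ P.grading j) :
    ∃ c : F, ∀ a, P.intg (P.d a * t) = c * P.intg (a * P.d t) := by
  refine ⟨-(-1) ^ (n - 1 - j), P.homogeneous_induction (fun i a ha => ?_) fun a b h h' => ?_⟩
  · by_cases hij : i + j + 1 = n
    · obtain rfl : i = n - 1 - j := by omega
      rw [P.intg_d_mul_of_mem ha, neg_mul]
    · rw [P.intg_mul_eq_zero (P.d_mem ha) ht (by omega),
        P.intg_mul_eq_zero ha (P.d_mem ht) (by omega), mul_zero]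
  · rw [map_add, add_mul, add_mul, map_add, map_add, h, h', mul_add]

theorem intg_d_mul_eq_zero (P : PoincareDGCA F A n) {j : ℤ} {t : A} (ht : t ∈ P.Zc j) (a : A) :
    P.intg (P.d a * t) = 0 := by
  obtain ⟨c, hc⟩ := P.exists_intg_d_mul ht.1
  rw [hc, LinearMap.mem_ker.1 ht.2, mul_zero, map_zero, mul_zero]

section Hodge

variable {P : PoincareDGCA F A n} {H B : ℤ → Submodule F A} {dm : A →ₗ[F] A}

theorem IsHodge.H_le_Zc (hP : P.IsHodge H B) (k : ℤ) : H k ≤ P.Zc k := (hP.1 k).1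

theorem IsHodge.H_le (hP : P.IsHodge H B) (k : ℤ) : H k ≤ P.grading k :=
  (hP.H_le_Zc k).trans inf_le_left

theorem IsHodge.d_H (hP : P.IsHodge H B) {k : ℤ} {h : A} (hh : h ∈ H k) : P.d h = 0 :=
  (hP.H_le_Zc k hh).2

theorem IsHodge.exists_decomp (hP : P.IsHodge H B) {k : ℤ} {a : A} (ha : a ∈ P.grading k) :
    ∃ c ∈ P.grading (k - 1), ∃ h ∈ H k, ∃ b ∈ B k, a = P.d c + h + b := by
  obtain ⟨x, hx, b, hb, rfl⟩ := Submodule.mem_sup.1 (hP.2.2.2.1 k ha)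
  obtain ⟨y, ⟨c, hc, rfl⟩, h, hh, rfl⟩ := Submodule.mem_sup.1 hx
  exact ⟨c, hc, h, hh, b, hb, rfl⟩

theorem IsHodge.d_dm_d (hP : P.IsHodge H B) (hdm : P.IsDminus H B dm) (a : A) :
    P.d (dm (P.d a)) = P.d a := by
  revert a
  refine P.homogeneous_induction (fun k a ha => ?_) fun a b h h' => ?_
  · obtain ⟨c, -, h, hh, b, hb, rfl⟩ := hP.exists_decomp ha
    simp only [map_add, P.d_d, hP.d_H hh, zero_add, hdm.1 k b hb]
  · rw [map_add, map_add, map_add, h, h']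

theorem IsHodge.dm_mem (hP : P.IsHodge H B) (hdm : P.IsDminus H B dm) {k : ℤ} {a : A}
    (ha : a ∈ P.grading k) : dm a ∈ P.grading (k - 1) :=
  hP.2.1 _ (hdm.2.2.2 k a ha)

theorem IsHodge.sub_sub_mem_H (hP : P.IsHodge H B) (hdm : P.IsDminus H B dm) {k : ℤ} {a : A}
    (ha : a ∈ P.grading k) : a - P.d (dm a) - dm (P.d a) ∈ H k := by
  obtain ⟨c, -, h, hh, b, hb, rfl⟩ := hP.exists_decomp ha
  have : P.d c + h + b - P.d (dm (P.d c + h + b)) - dm (P.d (P.d c + h + b)) = h := by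
    simp only [map_add, P.d_d, hP.d_H hh, hdm.2.1 k h hh, hdm.2.2.1 k b hb, hdm.1 k b hb,
      hP.d_dm_d hdm, add_zero, zero_add]
    abel
  rwa [this]

theorem IsHodge.mem_Bc_of_exact (hP : P.IsHodge H B) (hdm : P.IsDminus H B dm) {k : ℤ} {a : A}
    (ha : a ∈ P.grading k) (he : P.IsExact a) : a ∈ P.Bc k := by
  obtain ⟨c, rfl⟩ := he
  exact ⟨_, hP.dm_mem hdm ha, hP.d_dm_d hdm c⟩

theorem IsHodge.eq_zero_of_exact (hP : P.IsHodge H B) (hdm : P.IsDminus H B dm) {k : ℤ} {h : A}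
    (hh : h ∈ H k) (he : P.IsExact h) : h = 0 :=
  Submodule.disjoint_def.1 (hP.1 k).2.1 h (hP.mem_Bc_of_exact hdm (hP.H_le k hh) he) hh

/-- The pairing of a harmonic element with all harmonic elements detects it. -/
theorem IsHodge.eq_zero_of_intg (hP : P.IsHodge H B) (hdm : P.IsDminus H B dm) {k : ℤ} {h : A}
    (hh : h ∈ H k) (h0 : ∀ t ∈ H (n - k), P.intg (h * t) = 0) : h = 0 := by
  refine hP.eq_zero_of_exact hdm hh (P.nondeg k h (hP.H_le k hh) (hP.d_H hh) fun b hb hdb => ?_)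
  have hb' := hP.sub_sub_mem_H hdm hb
  rw [hdb, map_zero, sub_zero] at hb'
  have h1 := h0 _ hb'
  rw [mul_sub, map_sub, P.intg_mul_eq_zero_symm (b := P.d (dm b)) (hP.H_le k hh)
    (P.intg_d_mul_eq_zero (hP.H_le_Zc k hh) _), sub_zero] at h1
  exact h1

theorem IsHodge.intg_mul_B (hP : P.IsHodge H B) {j k : ℤ} {a b : A} (ha : a ∈ H j ⊔ B j)
    (hb : b ∈ B k) : P.intg (a * b) = 0 :=
  hP.2.2.2.2 j k a ha b hb

theorem IsHodge.intg_B_mul (hP : P.IsHodge H B) {j k : ℤ} {a b : A} (ha : a ∈ H j ⊔ B j)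
    (hb : b ∈ B k) : P.intg (b * a) = 0 :=
  P.intg_mul_eq_zero_symm (hP.2.1 k hb) (hP.intg_mul_B ha hb)

theorem IsHodge.intg_dm_mul_dm (hP : P.IsHodge H B) (hdm : P.IsDminus H B dm) {i j : ℤ} {a b : A}
    (ha : a ∈ P.grading i) (hb : b ∈ P.grading j) : P.intg (dm a * dm b) = 0 :=
  hP.intg_mul_B (Submodule.mem_sup_right (hdm.2.2.2 i a ha)) (hdm.2.2.2 j b hb)

theorem IsHodge.intg_dm_mul_of_mem (hP : P.IsHodge H B) (hdm : P.IsDminus H B dm) {i j : ℤ}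
    {a t : A} (ha : a ∈ P.grading i) (ht : t ∈ P.grading j) :
    (-1) ^ (i - 1) * P.intg (dm a * t) = - P.intg (a * dm t) := by
  have h1 : P.intg (dm a * t) = P.intg (dm a * P.d (dm t)) := by
    have h2 : P.intg (dm a * (t - P.d (dm t) - dm (P.d t))) = 0 :=
      hP.intg_B_mul (Submodule.mem_sup_left (hP.sub_sub_mem_H hdm ht)) (hdm.2.2.2 i a ha)
    rw [mul_sub, mul_sub, map_sub, map_sub, hP.intg_dm_mul_dm hdm ha (P.d_mem ht), sub_zero,
      sub_eq_zero] at h2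
    exact h2
  have h3 : P.intg (a * dm t) = P.intg (P.d (dm a) * dm t) := by
    have h4 : P.intg ((a - P.d (dm a) - dm (P.d a)) * dm t) = 0 :=
      hP.intg_mul_B (Submodule.mem_sup_left (hP.sub_sub_mem_H hdm ha)) (hdm.2.2.2 j t ht)
    rw [sub_mul, sub_mul, map_sub, map_sub, hP.intg_dm_mul_dm hdm (P.d_mem ha) ht, sub_zero,
      sub_eq_zero] at h4
    exact h4
  rw [h1, h3, P.intg_d_mul_of_mem (hP.dm_mem hdm ha), neg_neg]

theorem IsHodge.exists_intg_dm_mul (hP : P.IsHodge H B) (hdm : P.IsDminus H B dm) {j : ℤ} {t : A}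
    (ht : t ∈ P.grading j) : ∃ c : F, ∀ a, P.intg (dm a * t) = c * P.intg (a * dm t) := by
  refine ⟨-((-1) ^ (n - j))⁻¹, P.homogeneous_induction (fun i a ha => ?_) fun a b h h' => ?_⟩
  · by_cases hij : i - 1 + j = n
    · have h := hP.intg_dm_mul_of_mem hdm ha ht
      rw [show i - 1 = n - j by omega] at h
      rw [neg_mul, ← mul_neg, ← h, inv_mul_cancel_left₀ (zpow_ne_zero _ (by simp))]
    · rw [P.intg_mul_eq_zero (hP.dm_mem hdm ha) ht hij,
        P.intg_mul_eq_zero ha (hP.dm_mem hdm ht) (by omega), mul_zero]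
  · rw [map_add, add_mul, add_mul, map_add, map_add, h, h', mul_add]

end Hodge

end PoincareDGCA

namespace PoincareDGCA

variable {n : ℤ} {P : PoincareDGCA F A n} {H B : ℤ → Submodule F A} {dm : A →ₗ[F] A}

/-- The degree `k` part of a subalgebra. -/
def part (P : PoincareDGCA F A n) (C : Subalgebra F A) (k : ℤ) : Submodule F A :=
  Subalgebra.toSubmodule C ⊓ P.grading k

/-- The span, in degree `m`, of products of two elements of `C` of degree at least `r`. -/
def prodSpan (P : PoincareDGCA F A n) (C : Subalgebra F A) (r m : ℤ) : Submodule F A :=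
  Submodule.span F {x | ∃ i j, r ≤ i ∧ r ≤ j ∧ i + j = m ∧
    ∃ a ∈ P.part C i, ∃ b ∈ P.part C j, x = a * b}

theorem prodSpan_le_part (P : PoincareDGCA F A n) (C : Subalgebra F A) (r m : ℤ) :
    P.prodSpan C r m ≤ P.part C m := by
  refine Submodule.span_le.2 ?_
  rintro _ ⟨i, j, -, -, rfl, a, ha, b, hb, rfl⟩
  exact ⟨C.mul_mem ha.1 hb.1, P.mul_mem ha.2 hb.2⟩

theorem prodSpan_eq_bot (P : PoincareDGCA F A n) (C : Subalgebra F A) {r m : ℤ}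
    (h : m < 2 * r) : P.prodSpan C r m = ⊥ := by
  refine le_bot_iff.1 (Submodule.span_le.2 ?_)
  rintro _ ⟨i, j, hi, hj, rfl, -⟩
  omega

theorem mul_mem_prodSpan (P : PoincareDGCA F A n) {C : Subalgebra F A} {r i j : ℤ} (hi : r ≤ i)
    (hj : r ≤ j) {a b : A} (ha : a ∈ P.part C i) (hb : b ∈ P.part C j) :
    a * b ∈ P.prodSpan C r (i + j) :=
  Submodule.subset_span ⟨i, j, hi, hj, rfl, a, ha, b, hb, rfl⟩

/-- A family of homogeneous subspaces of `C`, trivial in degrees below `r` apart from the scalars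
and containing all products of elements of `C` of degrees at least `r`, sums to a subalgebra. -/
theorem exists_subalgebra_of_prodSpan_le (P : PoincareDGCA F A n) {C : Subalgebra F A} {r : ℤ}
    {N : ℤ → Submodule F A} (hN : ∀ k, N k ≤ P.part C k) (hM : ∀ k, P.prodSpan C r k ≤ N k)
    (hone : (1 : A) ∈ N 0) (hzero : N 0 ≤ Submodule.span F {1})
    (hlow : ∀ k, k ≠ 0 → k < r → N k = ⊥) :
    ∃ U : Subalgebra F A, Subalgebra.toSubmodule U = ⨆ k, N k := by
  refine ⟨(⨆ k, N k).toSubalgebra (Submodule.mem_iSup_of_mem 0 hone) ?_, rfl⟩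
  intro x y hx hy
  induction hx using Submodule.iSup_induction' with
  | zero => rw [zero_mul]; exact zero_mem _
  | add a b _ _ ha hb => rw [add_mul]; exact add_mem ha hb
  | mem i a ha =>
    induction hy using Submodule.iSup_induction' with
    | zero => rw [mul_zero]; exact zero_mem _
    | add b c _ _ hb hc => rw [mul_add]; exact add_mem hb hc
    | mem j b hb =>
      by_cases hi : i = 0
      · subst hi
        obtain ⟨c, rfl⟩ := Submodule.mem_span_singleton.1 (hzero ha)
        rw [smul_mul_assoc, one_mul]
        exact Submodule.smul_mem _ _ (Submodule.mem_iSup_of_mem j hb)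
      by_cases hj : j = 0
      · subst hj
        obtain ⟨c, rfl⟩ := Submodule.mem_span_singleton.1 (hzero hb)
        rw [mul_smul_comm, mul_one]
        exact Submodule.smul_mem _ _ (Submodule.mem_iSup_of_mem i ha)
      by_cases hir : i < r
      · rw [hlow i hi hir, Submodule.mem_bot] at ha
        rw [ha, zero_mul]; exact zero_mem _
      by_cases hjr : j < r
      · rw [hlow j hj hjr, Submodule.mem_bot] at hb
        rw [hb, mul_zero]; exact zero_mem _
      exact Submodule.mem_iSup_of_mem (i + j) (hM _
        (P.mul_mem_prodSpan (not_lt.1 hir) (not_lt.1 hjr) (hN _ ha) (hN _ hb)))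

theorem isHSubalgebra_smallAlgebra (P : PoincareDGCA F A n) (H : ℤ → Submodule F A)
    (dm : A →ₗ[F] A) : IsHSubalgebra P.toDGA H dm (smallAlgebra P.toDGA H dm) := by
  refine ⟨fun k h hh => ?_, fun a ha => ?_, fun a ha => ?_⟩
  · exact (Subalgebra.mem_toSubmodule _).2 (Algebra.mem_sInf.2 fun C hC => hC.1 k hh)
  · exact Algebra.mem_sInf.2 fun C hC => hC.2.1 a (Algebra.mem_sInf.1 ha C hC)
  · exact Algebra.mem_sInf.2 fun C hC => hC.2.2 a (Algebra.mem_sInf.1 ha C hC)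

theorem d_prodSpan_le {C : Subalgebra F A} (hC : ∀ a ∈ C, P.d a ∈ C) {r m : ℤ} {x : A}
    (hx : x ∈ P.prodSpan C r m) : P.d x ∈ P.prodSpan C r (m + 1) := by
  refine (Submodule.span_le (p := (P.prodSpan C r (m + 1)).comap P.d)).2 ?_ hx
  rintro _ ⟨i, j, hi, hj, rfl, a, ha, b, hb, rfl⟩
  rw [SetLike.mem_coe, Submodule.mem_comap, P.leibniz a b ha.2]
  refine add_mem ?_ (Submodule.smul_mem _ _ ?_)
  · rw [show i + j + 1 = i + 1 + j by ring]
    exact P.mul_mem_prodSpan (by omega) hj ⟨hC _ ha.1, P.d_mem ha.2⟩ hb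
  · rw [add_assoc]
    exact P.mul_mem_prodSpan hi (by omega) ha ⟨hC _ hb.1, P.d_mem hb.2⟩

section Connected

variable {r : ℤ}

theorem IsHodge.one_mem_H (hP : P.IsHodge H B) : (1 : A) ∈ H 0 := by
  have h := (hP.1 0).2.2 P.one_mem_Zc
  rwa [P.Bc_zero, bot_sup_eq] at h

theorem IsHodge.H_zero_le (hP : P.IsHodge H B) (hconn : P.RConnected (r - 1)) :
    H 0 ≤ Submodule.span F {1} := fun h hh => by
  obtain ⟨c, rfl⟩ := hconn.1 h (hP.H_le 0 hh) (hP.d_H hh)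
  exact Submodule.smul_mem _ _ (Submodule.mem_span_singleton_self 1)

theorem IsHodge.H_eq_bot (hP : P.IsHodge H B) (hdm : P.IsDminus H B dm)
    (hconn : P.RConnected (r - 1)) {k : ℤ} (hk : k ≠ 0) (hkr : k < r) : H k = ⊥ := by
  rcases hk.lt_or_gt with h | h
  · exact le_bot_iff.1 ((hP.H_le k).trans (P.nonneg k h).le)
  · refine (Submodule.eq_bot_iff _).2 fun a ha => hP.eq_zero_of_exact hdm ha ?_
    exact hconn.2 k (by omega) (by omega) a (hP.H_le k ha) (hP.d_H ha)

/-- In the connected case the small algebra is the sum of the harmonic spaces, the products of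
elements of the small algebra of degree at least `r`, and the images of these under `d⁻`. -/
theorem IsHodge.toSubmodule_smallAlgebra (hP : P.IsHodge H B) (hdm : P.IsDminus H B dm)
    (hr : 1 < r) (hconn : P.RConnected (r - 1)) :
    Subalgebra.toSubmodule (smallAlgebra P.toDGA H dm) =
      ⨆ k, (H k ⊔ P.prodSpan (smallAlgebra P.toDGA H dm) r k ⊔
        (P.prodSpan (smallAlgebra P.toDGA H dm) r (k + 1)).map dm) ∧
    ∀ k, (H k ⊔ P.prodSpan (smallAlgebra P.toDGA H dm) r k ⊔
        (P.prodSpan (smallAlgebra P.toDGA H dm) r (k + 1)).map dm) ≤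
      P.part (smallAlgebra P.toDGA H dm) k := by
  have hS := P.isHSubalgebra_smallAlgebra H dm
  set S := smallAlgebra P.toDGA H dm with hSdef
  have hle : ∀ k, (H k ⊔ P.prodSpan S r k ⊔ (P.prodSpan S r (k + 1)).map dm) ≤ P.part S k := by
    refine fun k => sup_le (sup_le (le_inf (hS.1 k) (hP.H_le k)) (P.prodSpan_le_part S r k)) ?_
    rintro _ ⟨x, hx, rfl⟩
    have hx' := P.prodSpan_le_part S r _ hx
    refine ⟨hS.2.2 x hx'.1, ?_⟩
    simpa using hP.dm_mem hdm hx'.2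
  refine ⟨le_antisymm ?_ (iSup_le fun k => (hle k).trans inf_le_left), hle⟩
  have hlow : ∀ k, k < 2 * r - 1 →
      H k ⊔ P.prodSpan S r k ⊔ (P.prodSpan S r (k + 1)).map dm = H k := fun k hk => by
    rw [P.prodSpan_eq_bot S (show k < 2 * r by omega),
      P.prodSpan_eq_bot S (show k + 1 < 2 * r by omega), Submodule.map_bot, sup_bot_eq, sup_bot_eq]
  obtain ⟨U, hU⟩ := P.exists_subalgebra_of_prodSpan_le hle
    (fun k => le_sup_right.trans le_sup_left)
    (by rw [hlow 0 (by omega)]; exact hP.one_mem_H)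
    (by rw [hlow 0 (by omega)]; exact hP.H_zero_le hconn)
    (fun k hk hkr => by rw [hlow k (by omega)]; exact hP.H_eq_bot hdm hconn hk hkr)
  rw [← hU]
  have hHU : ∀ k, H k ≤ Subalgebra.toSubmodule U := fun k => hU ▸
    le_iSup_of_le k (le_sup_left.trans le_sup_left)
  have hMU : ∀ k, P.prodSpan S r k ≤ Subalgebra.toSubmodule U := fun k => hU ▸
    le_iSup_of_le k (le_sup_right.trans le_sup_left)
  have hdU : ∀ k, (P.prodSpan S r k).map dm ≤ Subalgebra.toSubmodule U := fun k => hU ▸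
    le_iSup_of_le (k - 1) (by rw [sub_add_cancel]; exact le_sup_right)
  suffices hUH : IsHSubalgebra P.toDGA H dm U from
    fun a ha => Algebra.mem_sInf.1 ha U hUH
  refine ⟨hHU, ?_, ?_⟩
  · suffices Subalgebra.toSubmodule U ≤ (Subalgebra.toSubmodule U).comap P.d from this
    conv_lhs => rw [hU]
    refine iSup_le fun k => sup_le (sup_le (fun h hh => ?_) fun x hx => ?_) ?_
    · rw [Submodule.mem_comap, hP.d_H hh]; exact zero_mem _
    · exact hMU _ (d_prodSpan_le hS.2.1 hx)
    · rintro _ ⟨x, hx, rfl⟩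
      have h1 := hHU _ (hP.sub_sub_mem_H hdm (P.prodSpan_le_part S r _ hx).2)
      have h2 := hdU _ (Submodule.mem_map_of_mem (d_prodSpan_le hS.2.1 hx))
      have h3 := sub_mem (sub_mem (hMU _ hx) h1) h2
      rw [Submodule.mem_comap]
      convert h3 using 1
      abel
  · suffices Subalgebra.toSubmodule U ≤ (Subalgebra.toSubmodule U).comap dm from this
    conv_lhs => rw [hU]
    refine iSup_le fun k => sup_le (sup_le (fun h hh => ?_) fun x hx => ?_) ?_
    · rw [Submodule.mem_comap, hdm.2.1 k h hh]; exact zero_mem _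
    · exact hdU _ ⟨x, hx, rfl⟩
    · rintro _ ⟨x, hx, rfl⟩
      rw [Submodule.mem_comap, hdm.dm_dm]; exact zero_mem _

theorem IsHodge.part_smallAlgebra_le (hP : P.IsHodge H B) (hdm : P.IsDminus H B dm)
    (hr : 1 < r) (hconn : P.RConnected (r - 1)) (k : ℤ) :
    P.part (smallAlgebra P.toDGA H dm) k ≤
      H k ⊔ P.prodSpan (smallAlgebra P.toDGA H dm) r k ⊔
        (P.prodSpan (smallAlgebra P.toDGA H dm) r (k + 1)).map dm := by
  obtain ⟨h, hle⟩ := hP.toSubmodule_smallAlgebra hdm hr hconn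
  exact fun a ha => P.mem_of_mem_iSup (fun k => (hle k).trans inf_le_right) ha.2 (h ▸ ha.1)

theorem IsHodge.smallAlgebra_eq_iSup_part (hP : P.IsHodge H B) (hdm : P.IsDminus H B dm)
    (hr : 1 < r) (hconn : P.RConnected (r - 1)) :
    Subalgebra.toSubmodule (smallAlgebra P.toDGA H dm) =
      ⨆ k, P.part (smallAlgebra P.toDGA H dm) k := by
  obtain ⟨h, hle⟩ := hP.toSubmodule_smallAlgebra hdm hr hconn
  exact le_antisymm (h.le.trans (iSup_mono hle)) (iSup_le fun k => inf_le_left)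

theorem IsHodge.part_smallAlgebra_le_H (hP : P.IsHodge H B) (hdm : P.IsDminus H B dm)
    (hr : 1 < r) (hconn : P.RConnected (r - 1)) {k : ℤ} (hk : k ≤ 2 * r - 2) :
    P.part (smallAlgebra P.toDGA H dm) k ≤ H k := by
  refine (hP.part_smallAlgebra_le hdm hr hconn k).trans ?_
  rw [P.prodSpan_eq_bot _ (show k < 2 * r by omega),
    P.prodSpan_eq_bot _ (show k + 1 < 2 * r by omega), Submodule.map_bot, sup_bot_eq, sup_bot_eq]

theorem IsHodge.fg_H (hP : P.IsHodge H B) (hdm : P.IsDminus H B dm) (k : ℤ) : (H k).FG := by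
  obtain ⟨W, hW, h⟩ := P.fin_cohomology k
  set q := (LinearMap.range P.d).mkQ
  have hq : ∀ x : H k, q x ∈ W.map q := fun ⟨x, hx⟩ => by
    obtain ⟨w, hw, c, hc⟩ := h x (hP.H_le k hx) (hP.d_H hx)
    have hxw : q x = q w :=
      (Submodule.Quotient.eq (LinearMap.range P.d)).2 (LinearMap.mem_range.2 ⟨c, hc.symm⟩)
    exact hxw ▸ Submodule.mem_map_of_mem hw
  have hinj : Function.Injective ((q.domRestrict (H k)).codRestrict (W.map q) hq) := by
    rw [injective_iff_map_eq_zero]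
    rintro ⟨x, hx⟩ h0
    obtain ⟨c, hc⟩ := (Submodule.Quotient.mk_eq_zero _).1 (congrArg Subtype.val h0)
    exact Subtype.ext (hP.eq_zero_of_exact hdm hx ⟨c, hc.symm⟩)
  have := FiniteDimensional.of_injective _ hinj
  exact Module.Finite.iff_fg.1 this

theorem fg_prodSpan (P : PoincareDGCA F A n) {C : Subalgebra F A} {m : ℤ}
    (h : ∀ i, i ≤ m - r → (P.part C i).FG) : (P.prodSpan C r m).FG := by
  have hle : P.prodSpan C r m ≤
      ⨆ i ∈ Finset.Icc r (m - r), P.part C i * P.part C (m - i) := by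
    refine Submodule.span_le.2 ?_
    rintro _ ⟨i, j, hi, hj, rfl, a, ha, b, hb, rfl⟩
    refine Submodule.mem_iSup_of_mem i (Submodule.mem_iSup_of_mem (by simp; omega) ?_)
    rw [add_sub_cancel_left]
    exact Submodule.mul_mem_mul ha hb
  have hfg : (⨆ i ∈ Finset.Icc r (m - r), P.part C i * P.part C (m - i)).FG := by
    refine Submodule.fg_biSup _ _ fun i hi => ?_
    rw [Finset.mem_Icc] at hi
    exact (h i hi.2).mul (h _ (by omega))
  have := Module.Finite.iff_fg.2 hfg
  exact Module.Finite.iff_fg.1 (Submodule.finiteDimensional_of_le hle)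

theorem IsHodge.fg_part (hP : P.IsHodge H B) (hdm : P.IsDminus H B dm)
    (hr : 1 < r) (hconn : P.RConnected (r - 1)) (k : ℤ) :
    (P.part (smallAlgebra P.toDGA H dm) k).FG := by
  suffices ∀ N : ℕ, ∀ k : ℤ, k < N → (P.part (smallAlgebra P.toDGA H dm) k).FG from
    this (k.toNat + 1) k (by omega)
  intro N
  induction N with
  | zero =>
    intro k hk
    rw [part, P.nonneg k (by simpa using hk), inf_bot_eq]
    exact Submodule.fg_bot
  | succ N ih =>
    intro k hk
    have hfg := ((hP.fg_H hdm k).sup (P.fg_prodSpan (r := r) (m := k)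
      fun i hi => ih i (by push_cast at hk; omega))).sup
      ((P.fg_prodSpan (r := r) (m := k + 1) fun i hi => ih i (by push_cast at hk; omega)).map dm)
    have := Module.Finite.iff_fg.2 hfg
    exact Module.Finite.iff_fg.1
      (Submodule.finiteDimensional_of_le (hP.part_smallAlgebra_le hdm hr hconn k))

theorem IsHodge.finiteDimensional_smallAlgebra (hP : P.IsHodge H B) (hdm : P.IsDminus H B dm)
    (hr : 1 < r) (hconn : P.RConnected (r - 1)) :
    FiniteDimensional F (smallAlgebra P.toDGA H dm) := by
  have hle : Subalgebra.toSubmodule (smallAlgebra P.toDGA H dm) ≤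
      ⨆ k ∈ Finset.Icc 0 n, P.part (smallAlgebra P.toDGA H dm) k := by
    rw [hP.smallAlgebra_eq_iSup_part hdm hr hconn]
    refine iSup_le fun k => ?_
    by_cases hk : k ∈ Finset.Icc 0 n
    · exact le_iSup₂_of_le k hk le_rfl
    · have : P.grading k = ⊥ := by
        rw [Finset.mem_Icc, not_and_or, not_le, not_le] at hk
        exact hk.elim (P.nonneg k) (P.top k)
      rw [part, this, inf_bot_eq]
      exact bot_le
  have := Module.Finite.iff_fg.2 (Submodule.fg_biSup (Finset.Icc 0 n)
    (fun k => P.part (smallAlgebra P.toDGA H dm) k) fun k _ => hP.fg_part hdm hr hconn k)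
  exact Submodule.finiteDimensional_of_le hle

end Connected

end PoincareDGCA

section SymmetricSquare

theorem gradedFlip_gradedFlip (r : ℤ) (M : Submodule F A) (t : M ⊗[F] M) :
    gradedFlip r M (gradedFlip r M t) = t := by
  have h : ((-1 : F) ^ (r * r)) * (-1) ^ (r * r) = 1 := by
    rw [← mul_zpow]; simp
  simp [gradedFlip, smul_smul, h]

theorem mulTensor_gradedFlip (D : DGCA F A) {r : ℤ} {M : Submodule F A} (hM : M ≤ D.grading r)
    (t : M ⊗[F] M) : mulTensor M (gradedFlip r M t) = mulTensor M t := by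
  induction t with
  | zero => simp
  | add x y hx hy => rw [map_add, map_add, map_add, hx, hy]
  | tmul x y =>
    rw [gradedFlip, LinearMap.smul_apply, map_smul]
    exact (D.gcomm x.1 y.1 (hM x.2) (hM y.2)).symm

/-- If multiplication is injective in cohomology on graded symmetric tensors, every exact product
of arbitrary tensors vanishes. -/
theorem mulTensor_eq_zero_of_isExact (D : DGCA F A) {r : ℤ} {M : Submodule F A}
    (hM : M ≤ D.grading r)
    (hinj : ∀ t : M ⊗[F] M, gradedFlip r M t = t → D.IsExact (mulTensor M t) → t = 0)
    {t : M ⊗[F] M} (ht : D.IsExact (mulTensor M t)) : mulTensor M t = 0 := by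
  have hflip : t + gradedFlip r M t = 0 := by
    refine hinj _ (by rw [map_add, gradedFlip_gradedFlip, add_comm]) ?_
    obtain ⟨c, hc⟩ := ht
    exact ⟨c + c, by rw [map_add, mulTensor_gradedFlip D hM, map_add, hc]⟩
  by_cases h2 : (2 : F) = 0
  · have htwo : t + t = 0 := by rw [← two_smul F t, h2, zero_smul]
    have hfix : gradedFlip r M t = t := by
      rw [← zero_add (gradedFlip r M t), ← htwo, add_assoc, hflip, add_zero]
    rw [hinj t hfix ht, map_zero]
  · have h := congrArg (mulTensor M) hflip
    rw [map_add, mulTensor_gradedFlip D hM, map_zero, ← two_smul F] at h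
    exact (smul_eq_zero.1 h).resolve_left h2

end SymmetricSquare

namespace PoincareDGCA

variable {n r : ℤ} {P : PoincareDGCA F A n} {H B : ℤ → Submodule F A} {dm : A →ₗ[F] A}

theorem IsHodge.H_le_part (hP : P.IsHodge H B) (k : ℤ) :
    H k ≤ P.part (smallAlgebra P.toDGA H dm) k :=
  le_inf ((P.isHSubalgebra_smallAlgebra H dm).1 k) (hP.H_le k)

/-- An adapted harmonic space consists of generators and products. -/
theorem IsHodge.H_le_of_adapted (hP : P.IsHodge H B) (hdm : P.IsDminus H B dm)
    (hr : 1 < r) (hconn : P.RConnected (r - 1)) {G : ℤ → Submodule F A}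
    (hG : IsGeneratingFamily P.toDGA G) (hGH : IsAdaptedHarmonic P.toDGA G H) {k : ℤ}
    (hk : k ≠ 0) : H k ≤ G k ⊔ P.prodSpan (smallAlgebra P.toDGA H dm) r k := by
  set S := smallAlgebra P.toDGA H dm
  set N : ℤ → Submodule F A := fun k => if k = 0 then H 0 else G k ⊔ P.prodSpan S r k with hN
  have hNk : ∀ {k}, k ≠ 0 → N k = G k ⊔ P.prodSpan S r k := fun hk => if_neg hk
  have hN0 : N 0 = H 0 := if_pos rfl
  have hGN : ∀ k, G k ≤ N k := fun k => by
    by_cases hk : k = 0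
    · rw [hG.2.1 k hk.le]; exact bot_le
    · rw [hNk hk]; exact le_sup_left
  have hNpart : ∀ k, N k ≤ P.part S k := fun k => by
    by_cases hk : k = 0
    · subst hk; rw [hN0]; exact hP.H_le_part 0
    · rw [hNk hk]
      exact sup_le ((hGH.2.1 k).trans (hP.H_le_part k)) (P.prodSpan_le_part S r k)
  obtain ⟨U, hU⟩ := P.exists_subalgebra_of_prodSpan_le (r := r) hNpart
    (fun k => by
      by_cases hk : k = 0
      · rw [P.prodSpan_eq_bot S (by omega)]; exact bot_le
      · rw [hNk hk]; exact le_sup_right)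
    (by rw [hN0]; exact hP.one_mem_H) (by rw [hN0]; exact hP.H_zero_le hconn)
    (fun k hk hkr => by
      rw [hNk hk, P.prodSpan_eq_bot S (by omega), sup_bot_eq]
      exact le_bot_iff.1 ((hGH.2.1 k).trans (hP.H_eq_bot hdm hconn hk hkr).le))
  have hadj : Algebra.adjoin F {a : A | ∃ j : ℤ, a ∈ G j} ≤ U := by
    refine Algebra.adjoin_le ?_
    rintro a ⟨j, ha⟩
    have : a ∈ Subalgebra.toSubmodule U := hU ▸ Submodule.mem_iSup_of_mem j (hGN j ha)
    exact this
  rw [← hNk hk]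
  intro h hh
  refine P.mem_of_mem_iSup (fun k => (hNpart k).trans inf_le_right) (hP.H_le k hh) ?_
  rw [← hU]
  exact hadj (hGH.2.2 k hh)

theorem IsHodge.part_smallAlgebra_le_H_of_injective (hP : P.IsHodge H B) (hdm : P.IsDminus H B dm)
    (hr : 1 < r) (hconn : P.RConnected (r - 1)) {G : ℤ → Submodule F A}
    (hG : IsGeneratingFamily P.toDGA G) (hGH : IsAdaptedHarmonic P.toDGA G H)
    (hinj : ∀ t : H r ⊗[F] H r, gradedFlip r (H r) t = t →
      P.IsExact (mulTensor (H r) t) → t = 0) :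
    P.part (smallAlgebra P.toDGA H dm) (2 * r - 1) ≤ H (2 * r - 1) := by
  set S := smallAlgebra P.toDGA H dm
  have hmul : ∀ x ∈ P.prodSpan S r (2 * r), ∃ a, mulTensor (H r) a = x := by
    suffices P.prodSpan S r (2 * r) ≤ LinearMap.range (mulTensor (H r)) from
      fun x hx => LinearMap.mem_range.1 (this hx)
    refine Submodule.span_le.2 ?_
    rintro _ ⟨i, j, hi, hj, hij, a, ha, b, hb, rfl⟩
    obtain rfl : i = r := by omega
    obtain rfl : j = i := by omega
    exact ⟨⟨a, hP.part_smallAlgebra_le_H hdm hr hconn (by omega) ha⟩ ⊗ₜ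
      ⟨b, hP.part_smallAlgebra_le_H hdm hr hconn (by omega) hb⟩, rfl⟩
  have hpos : P.prodSpan S r (2 * r) ≤ posProdSpan P.toDGA (2 * r) := by
    refine Submodule.span_le.2 ?_
    rintro _ ⟨i, j, hi, hj, hij, a, ha, b, hb, rfl⟩
    exact Submodule.subset_span ⟨i, j, by omega, by omega, hij,
      a, hP.H_le_Zc _ (hP.part_smallAlgebra_le_H hdm hr hconn (by omega) ha),
      b, hP.H_le_Zc _ (hP.part_smallAlgebra_le_H hdm hr hconn (by omega) hb), rfl⟩
  have hcl : P.prodSpan S r (2 * r) ≤ P.Zc (2 * r) := by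
    refine Submodule.span_le.2 ?_
    rintro _ ⟨i, j, hi, hj, hij, a, ha, b, hb, rfl⟩
    refine ⟨hij ▸ P.mul_mem ha.2 hb.2, ?_⟩
    rw [SetLike.mem_coe, LinearMap.mem_ker, P.leibniz a b ha.2,
      hP.d_H (hP.part_smallAlgebra_le_H hdm hr hconn (by omega) ha),
      hP.d_H (hP.part_smallAlgebra_le_H hdm hr hconn (by omega) hb)]
    simp
  have hprod : P.prodSpan S r (2 * r) ≤ H (2 * r) := by
    intro p hp
    obtain ⟨e, he, h, hh, rfl⟩ := Submodule.mem_sup.1 ((hP.1 (2 * r)).2.2 (hcl hp))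
    obtain ⟨g, hg, q, hq, rfl⟩ := Submodule.mem_sup.1
      (hP.H_le_of_adapted hdm hr hconn hG hGH (by omega) hh)
    have hg0 : g = 0 := by
      refine Submodule.disjoint_def.1 (hG.2.2.1 (2 * r)) g hg ?_
      have : g = (e + (g + q) - q) - e := by abel
      rw [this]
      exact sub_mem (Submodule.mem_sup_left (hpos (sub_mem hp hq))) (Submodule.mem_sup_right he)
    subst hg0
    rw [zero_add] at *
    have he' : e ∈ P.prodSpan S r (2 * r) := by simpa using sub_mem hp hq
    obtain ⟨t, rfl⟩ := hmul e he'
    obtain ⟨c, -, hc⟩ := he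
    rw [mulTensor_eq_zero_of_isExact P.toDGCA (hP.H_le r) hinj ⟨c, hc.symm⟩, zero_add]
    exact hh
  refine (hP.part_smallAlgebra_le hdm hr hconn _).trans ?_
  rw [P.prodSpan_eq_bot _ (show 2 * r - 1 < 2 * r by omega), sub_add_cancel, sup_bot_eq]
  refine sup_le le_rfl ?_
  rintro _ ⟨x, hx, rfl⟩
  rw [hdm.2.1 _ x (hprod hx)]
  exact zero_mem _

end PoincareDGCA

/-- The restriction of a linear endomorphism to an invariant subalgebra. -/
def Subalgebra.restrictLinear (C : Subalgebra F A) (f : A →ₗ[F] A) (hf : ∀ a ∈ C, f a ∈ C) :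
    C →ₗ[F] C where
  toFun s := ⟨f (s : A), hf s s.2⟩
  map_add' s t := Subtype.ext (map_add f (s : A) (t : A))
  map_smul' c s := Subtype.ext (map_smul f c (s : A))

namespace PoincareDGCA

variable {n : ℤ}

/-- `C` is a graded `H*`-subalgebra with respect to a Hodge type decomposition. -/
structure IsGradedHSubalgebra (P : PoincareDGCA F A n) (H B : ℤ → Submodule F A)
    (dm : A →ₗ[F] A) (C : Subalgebra F A) : Prop where
  isHodge : P.IsHodge H B
  isDminus : P.IsDminus H B dm
  isHSubalgebra : IsHSubalgebra P.toDGA H dm C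
  graded : Subalgebra.toSubmodule C = ⨆ k, P.part C k

/-- `π` is the projection of `C` onto the quotient by the null space of the pairing on `C`. -/
structure IsNullQuotient (P : PoincareDGCA F A n) {C : Subalgebra F A} {Q : Type v} [Ring Q]
    [Algebra F Q] (π : C →ₐ[F] Q) : Prop where
  surjective : Function.Surjective π
  eq_zero_iff : ∀ s, π s = 0 ↔ ∀ t : C, P.intg (s * t) = 0

variable {P : PoincareDGCA F A n} {H B : ℤ → Submodule F A} {dm : A →ₗ[F] A}
  {C : Subalgebra F A}

namespace IsGradedHSubalgebra

theorem intg_mul_eq_zero_of_part (hC : P.IsGradedHSubalgebra H B dm C) {x : A}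
    (h : ∀ j, ∀ t ∈ P.part C j, P.intg (x * t) = 0) (t : C) : P.intg (x * t) = 0 := by
  have hle : Subalgebra.toSubmodule C ≤ LinearMap.ker (P.intg ∘ₗ LinearMap.mulLeft F x) := by
    rw [hC.graded]
    exact iSup_le fun j t ht => h j t ht
  exact hle t.2

theorem d_mem (hC : P.IsGradedHSubalgebra H B dm C) {a : A} (ha : a ∈ C) : P.d a ∈ C :=
  hC.isHSubalgebra.2.1 a ha

theorem dm_mem (hC : P.IsGradedHSubalgebra H B dm C) {a : A} (ha : a ∈ C) : dm a ∈ C :=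
  hC.isHSubalgebra.2.2 a ha

theorem H_le (hC : P.IsGradedHSubalgebra H B dm C) {k : ℤ} {a : A} (ha : a ∈ H k) : a ∈ C :=
  hC.isHSubalgebra.1 k ha

/-- The differential on `C`. -/
def d (hC : P.IsGradedHSubalgebra H B dm C) : C →ₗ[F] C :=
  C.restrictLinear P.d hC.isHSubalgebra.2.1

/-- The operator `d⁻` on `C`. -/
def dminus (hC : P.IsGradedHSubalgebra H B dm C) : C →ₗ[F] C :=
  C.restrictLinear dm hC.isHSubalgebra.2.2

theorem coe_d (hC : P.IsGradedHSubalgebra H B dm C) (s : C) : (hC.d s : A) = P.d s := rfl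

theorem coe_dminus (hC : P.IsGradedHSubalgebra H B dm C) (s : C) : (hC.dminus s : A) = dm s := rfl

/-- The structure of a DGCA on a graded `H*`-subalgebra. -/
def toDGCA (hC : P.IsGradedHSubalgebra H B dm C) : DGCA F C where
  grading k := (P.grading k).comap C.val.toLinearMap
  internal := by
    rw [DirectSum.isInternal_submodule_iff_iSupIndep_and_iSup_eq_top]
    constructor
    · intro i
      rw [Submodule.disjoint_def]
      intro x hx hx'
      have hle : ⨆ (j) (_ : j ≠ i), (P.grading j).comap C.val.toLinearMap ≤
          (⨆ (j) (_ : j ≠ i), P.grading j).comap C.val.toLinearMap :=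
        iSup₂_le fun j hj => Submodule.comap_mono (le_iSup₂_of_le j hj le_rfl)
      exact Subtype.ext (Submodule.disjoint_def.1 (P.internal.submodule_iSupIndep i) _ hx
        (hle hx'))
    · rw [eq_top_iff]
      have hle : Subalgebra.toSubmodule C ≤
          (⨆ j, (P.grading j).comap C.val.toLinearMap).map C.val.toLinearMap := by
        rw [hC.graded]
        refine iSup_le fun j t ht => ?_
        have ht' : (⟨t, ht.1⟩ : C) ∈ (P.grading j).comap C.val.toLinearMap := ht.2
        exact ⟨_, le_iSup (fun j => (P.grading j).comap C.val.toLinearMap) j ht', rfl⟩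
      rintro ⟨x, hx⟩ -
      obtain ⟨y, hy, hyx⟩ := hle hx
      rwa [← (Subtype.ext hyx : y = ⟨x, hx⟩)]
  nonneg i hi := by
    rw [Submodule.eq_bot_iff]
    intro x hx
    rw [P.nonneg i hi] at hx
    exact Subtype.ext hx
  one_mem := P.one_mem
  mul_mem ha hb := P.mul_mem ha hb
  d := hC.d
  d_mem ha := P.d_mem ha
  d_d a := Subtype.ext (P.d_d a)
  leibniz a b ha := Subtype.ext (P.leibniz (a : A) b ha)
  gcomm a b ha hb := Subtype.ext (P.gcomm (a : A) b ha hb)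

/-- The harmonic part of an element of `C`. -/
def harm (hC : P.IsGradedHSubalgebra H B dm C) (s : C) : C :=
  s - hC.d (hC.dminus s) - hC.dminus (hC.d s)

theorem harm_mem (hC : P.IsGradedHSubalgebra H B dm C) {k : ℤ} {s : C}
    (hs : (s : A) ∈ P.grading k) : (hC.harm s : A) ∈ H k :=
  hC.isHodge.sub_sub_mem_H hC.isDminus hs

theorem eq_add_harm (hC : P.IsGradedHSubalgebra H B dm C) (s : C) :
    s = hC.d (hC.dminus s) + hC.harm s + hC.dminus (hC.d s) := by
  rw [harm]; abel

theorem exists_nullQuotient (hC : P.IsGradedHSubalgebra H B dm C) :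
    ∃ (Q : Type v) (_ : Ring Q) (_ : Algebra F Q) (π : C →ₐ[F] Q), P.IsNullQuotient π := by
  let I : Ideal C :=
    { carrier := {s | ∀ t : C, P.intg (s * t) = 0}
      add_mem' := fun {s s'} hs hs' t => by
        rw [Subalgebra.coe_add, add_mul, map_add, hs t, hs' t, add_zero]
      zero_mem' := fun t => by rw [Subalgebra.coe_zero, zero_mul, map_zero]
      smul_mem' := fun u s hs t => by
        have hle : Subalgebra.toSubmodule C ≤
            LinearMap.ker (P.intg ∘ₗ LinearMap.mulRight F ((s : A) * t)) := by
          rw [hC.graded]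
          refine iSup_le fun j u hu => ?_
          obtain ⟨c, hc⟩ := P.exists_intg_mul_comm hu.2
          have h0 := hs (t * ⟨u, hu.1⟩)
          rw [Subalgebra.coe_mul, ← mul_assoc] at h0
          rw [LinearMap.mem_ker, LinearMap.comp_apply, LinearMap.mulRight_apply, hc, h0, mul_zero]
        have h := LinearMap.mem_ker.1 (hle u.2)
        rw [LinearMap.comp_apply, LinearMap.mulRight_apply, ← mul_assoc] at h
        exact h }
  have hI : I.IsTwoSided := ⟨fun {s} u hs t => by
    have h := hs (u * t)
    rwa [Subalgebra.coe_mul, ← mul_assoc] at h⟩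
  exact ⟨C ⧸ I, inferInstance, inferInstance, Ideal.Quotient.mkₐ F I,
    Ideal.Quotient.mkₐ_surjective F I, fun s => Ideal.Quotient.eq_zero_iff_mem⟩

end IsGradedHSubalgebra

namespace IsNullQuotient

variable {Q : Type v} [Ring Q] [Algebra F Q] {π : C →ₐ[F] Q}

theorem eq_zero_of_part (hπ : P.IsNullQuotient π) (hC : P.IsGradedHSubalgebra H B dm C) {s : C}
    (h : ∀ j, ∀ t ∈ P.part C j, P.intg (s * t) = 0) : π s = 0 :=
  (hπ.eq_zero_iff s).2 (hC.intg_mul_eq_zero_of_part h)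

theorem map_d_eq_zero (hπ : P.IsNullQuotient π) (hC : P.IsGradedHSubalgebra H B dm C) {s : C}
    (hs : π s = 0) : π (hC.d s) = 0 := by
  refine hπ.eq_zero_of_part hC fun j t ht => ?_
  obtain ⟨c, hc⟩ := P.exists_intg_d_mul ht.2
  rw [hC.coe_d, hc, (hπ.eq_zero_iff s).1 hs ⟨_, hC.d_mem ht.1⟩, mul_zero]

theorem map_dminus_eq_zero (hπ : P.IsNullQuotient π) (hC : P.IsGradedHSubalgebra H B dm C)
    {s : C} (hs : π s = 0) : π (hC.dminus s) = 0 := by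
  refine hπ.eq_zero_of_part hC fun j t ht => ?_
  obtain ⟨c, hc⟩ := hC.isHodge.exists_intg_dm_mul hC.isDminus ht.2
  rw [hC.coe_dminus, hc, (hπ.eq_zero_iff s).1 hs ⟨_, hC.dm_mem ht.1⟩, mul_zero]

theorem intg_eq_zero (hπ : P.IsNullQuotient π) {s : C} (hs : π s = 0) : P.intg s = 0 := by
  simpa using (hπ.eq_zero_iff s).1 hs 1

/-- A harmonic element of the null space of `C` vanishes. -/
theorem eq_zero_of_mem_H (hπ : P.IsNullQuotient π) (hC : P.IsGradedHSubalgebra H B dm C) {k : ℤ}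
    {s : C} (hs : (s : A) ∈ H k) (h : π s = 0) : s = 0 :=
  Subtype.ext (hC.isHodge.eq_zero_of_intg hC.isDminus hs
    fun t ht => (hπ.eq_zero_iff s).1 h ⟨t, hC.H_le ht⟩)

theorem exists_d (hπ : P.IsNullQuotient π) (hC : P.IsGradedHSubalgebra H B dm C) :
    ∃ f : Q →ₗ[F] Q, ∀ s, f (π s) = π (hC.d s) :=
  π.toLinearMap.exists_factor_of_ker_le hπ.surjective (π.toLinearMap ∘ₗ hC.d)
    fun _ hs => hπ.map_d_eq_zero hC hs

theorem exists_intg (hπ : P.IsNullQuotient π) : ∃ f : Q →ₗ[F] F, ∀ s, f (π s) = P.intg s :=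
  π.toLinearMap.exists_factor_of_ker_le hπ.surjective (P.intg ∘ₗ C.val.toLinearMap)
    fun _ hs => hπ.intg_eq_zero hs

/-- The differential on the quotient. -/
noncomputable def d (hπ : P.IsNullQuotient π) (hC : P.IsGradedHSubalgebra H B dm C) :
    Q →ₗ[F] Q :=
  (hπ.exists_d hC).choose

/-- The integral on the quotient. -/
noncomputable def intg (hπ : P.IsNullQuotient π) : Q →ₗ[F] F := hπ.exists_intg.choose

theorem d_apply (hπ : P.IsNullQuotient π) (hC : P.IsGradedHSubalgebra H B dm C) (s : C) :
    hπ.d hC (π s) = π (hC.d s) :=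
  (hπ.exists_d hC).choose_spec s

theorem intg_apply (hπ : P.IsNullQuotient π) (s : C) : hπ.intg (π s) = P.intg s :=
  hπ.exists_intg.choose_spec s

theorem intg_mul_apply (hπ : P.IsNullQuotient π) (s t : C) :
    hπ.intg (π s * π t) = P.intg (s * t) := by
  rw [← map_mul, hπ.intg_apply, Subalgebra.coe_mul]

/-- The image in the quotient of a graded family. -/
def mapFamily (π : C →ₐ[F] Q) (N : ℤ → Submodule F A) (k : ℤ) : Submodule F Q :=
  ((N k).comap C.val.toLinearMap).map π.toLinearMap

theorem iSupIndep_mapFamily (hπ : P.IsNullQuotient π) (hC : P.IsGradedHSubalgebra H B dm C) :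
    iSupIndep (mapFamily π P.grading) := by
  intro i
  rw [Submodule.disjoint_def]
  rintro _ ⟨s, hs, rfl⟩ hs'
  refine hπ.eq_zero_of_part hC fun j t ht => ?_
  by_cases hij : i + j = n
  · have hle : ⨆ (k) (_ : k ≠ i), mapFamily π P.grading k ≤
        LinearMap.ker (hπ.intg ∘ₗ LinearMap.mulRight F (π ⟨t, ht.1⟩)) := by
      refine iSup₂_le fun k hk => ?_
      rintro _ ⟨s', hs', rfl⟩
      exact (hπ.intg_mul_apply s' ⟨t, ht.1⟩).trans (P.intg_mul_eq_zero hs' ht.2 (by omega))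
    exact (hπ.intg_mul_apply s ⟨t, ht.1⟩).symm.trans (hle hs')
  · exact P.intg_mul_eq_zero hs ht.2 hij

theorem iSup_mapFamily (hπ : P.IsNullQuotient π) (hC : P.IsGradedHSubalgebra H B dm C) :
    ⨆ k, mapFamily π P.grading k = ⊤ := by
  have h := hC.toDGCA.iSup_grading
  refine (Submodule.map_iSup π.toLinearMap hC.toDGCA.grading).symm.trans ?_
  rw [h, Submodule.map_top, LinearMap.range_eq_top]
  exact hπ.surjective

/-- The structure of a DGCA on the quotient of `C` by the null space of its pairing. -/
noncomputable def toDGCA (hπ : P.IsNullQuotient π) (hC : P.IsGradedHSubalgebra H B dm C) :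
    DGCA F Q where
  grading := mapFamily π P.grading
  internal := DirectSum.isInternal_submodule_of_iSupIndep_of_iSup_eq_top
    (hπ.iSupIndep_mapFamily hC) (hπ.iSup_mapFamily hC)
  nonneg i hi := by
    rw [Submodule.eq_bot_iff]
    rintro _ ⟨s, hs, rfl⟩
    have hs' : s ∈ hC.toDGCA.grading i := hs
    rw [hC.toDGCA.nonneg i hi, Submodule.mem_bot] at hs'
    rw [hs', map_zero]
  one_mem := ⟨1, P.one_mem, map_one π⟩
  mul_mem := by
    rintro i j _ _ ⟨s, hs, rfl⟩ ⟨t, ht, rfl⟩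
    exact ⟨s * t, P.mul_mem hs ht, map_mul π s t⟩
  d := hπ.d hC
  d_mem := by
    rintro i _ ⟨s, hs, rfl⟩
    exact ⟨hC.d s, P.d_mem hs, (hπ.d_apply hC s).symm⟩
  d_d q := by
    obtain ⟨s, rfl⟩ := hπ.surjective q
    rw [hπ.d_apply, hπ.d_apply, ← map_zero π]
    exact congrArg π (hC.toDGCA.d_d s)
  leibniz := by
    rintro i _ q ⟨s, hs, rfl⟩
    obtain ⟨t, rfl⟩ := hπ.surjective q
    have h := congrArg π (hC.toDGCA.leibniz s t hs)
    rw [map_add, map_smul] at h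
    have h1 := map_mul π (hC.d s) t
    have h2 := map_mul π s (hC.d t)
    rw [← hπ.d_apply] at h1 h2
    exact (congrArg (hπ.d hC) (map_mul π s t).symm).trans ((hπ.d_apply hC _).trans
      (h.trans (congrArg₂ (· + ·) h1 (congrArg _ h2))))
  gcomm := by
    rintro i j _ _ ⟨s, hs, rfl⟩ ⟨t, ht, rfl⟩
    have h := congrArg π (hC.toDGCA.gcomm s t hs ht)
    rwa [map_smul, map_mul, map_mul] at h

/-- The structure of a Poincaré DGCA on the quotient of `C` by the null space of its pairing. -/
noncomputable def toPoincareDGCA (hπ : P.IsNullQuotient π)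
    (hC : P.IsGradedHSubalgebra H B dm C) (hfin : FiniteDimensional F Q) :
    PoincareDGCA F Q n where
  toDGCA := hπ.toDGCA hC
  top i hi := by
    rw [Submodule.eq_bot_iff]
    rintro _ ⟨s, hs, rfl⟩
    have hs' : (s : A) ∈ P.grading i := hs
    rw [P.top i hi, Submodule.mem_bot] at hs'
    rw [(Subtype.ext hs' : s = 0), map_zero]
  fin_cohomology _ := ⟨⊤, inferInstance, fun a _ _ => ⟨a, trivial, 0, by simp⟩⟩
  intg := hπ.intg
  intg_deg := by
    rintro i hi _ ⟨s, hs, rfl⟩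
    exact (hπ.intg_apply s).trans (P.intg_deg i hi s hs)
  intg_d q := by
    obtain ⟨s, rfl⟩ := hπ.surjective q
    exact (congrArg hπ.intg (hπ.d_apply hC s)).trans ((hπ.intg_apply _).trans (P.intg_d s))
  nondeg := by
    rintro i _ ⟨s, hs, rfl⟩ hds h
    have hds' : π (hC.d s) = 0 := (hπ.d_apply hC s).symm.trans hds
    have hdds := hπ.map_dminus_eq_zero hC hds'
    have hharm : hC.harm s = 0 := by
      refine Subtype.ext (hC.isHodge.eq_zero_of_intg hC.isDminus (hC.harm_mem hs)
        fun t ht => ?_)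
      have hd : hC.d ⟨t, hC.H_le ht⟩ = 0 := Subtype.ext (hC.isHodge.d_H ht)
      have h1 : P.intg (s * t) = 0 := (hπ.intg_mul_apply s ⟨t, hC.H_le ht⟩).symm.trans
        (h (π ⟨t, hC.H_le ht⟩) ⟨_, hC.isHodge.H_le _ ht, rfl⟩
          ((hπ.d_apply hC _).trans (by rw [hd, map_zero])))
      have h2 : P.intg (P.d (dm s) * t) = 0 :=
        P.intg_d_mul_eq_zero (hC.isHodge.H_le_Zc _ ht) _
      have h3 : P.intg (dm (P.d s) * t) = 0 := (hπ.eq_zero_iff _).1 hdds ⟨t, hC.H_le ht⟩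
      change P.intg ((s - P.d (dm s) - dm (P.d s)) * t) = 0
      rw [sub_mul, sub_mul, map_sub, map_sub, h1, h2, h3, sub_zero, sub_zero]
    refine ⟨π (hC.dminus s), Eq.trans ?_ (hπ.d_apply hC _).symm⟩
    have h := congrArg π (hC.eq_add_harm s)
    rw [hharm, map_add, map_add, hdds, map_zero, add_zero, add_zero] at h
    exact h

theorem perp_eq_bot (hπ : P.IsNullQuotient π) (hC : P.IsGradedHSubalgebra H B dm C)
    (hfin : FiniteDimensional F Q) : (hπ.toPoincareDGCA hC hfin).perp = ⊥ := by
  rw [Submodule.eq_bot_iff]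
  intro q hq
  obtain ⟨s, rfl⟩ := hπ.surjective q
  refine (hπ.eq_zero_iff s).2 fun t => ?_
  exact (hπ.intg_mul_apply s t).symm.trans ((Submodule.mem_iInf _).1 hq (π t))

theorem isHodge (hπ : P.IsNullQuotient π) (hC : P.IsGradedHSubalgebra H B dm C)
    (hfin : FiniteDimensional F Q) :
    (hπ.toPoincareDGCA hC hfin).IsHodge (mapFamily π H) (mapFamily π B) := by
  refine ⟨fun k => ⟨?_, ?_, ?_⟩, ?_, ?_, ?_, ?_⟩
  · rintro _ ⟨s, hs, rfl⟩
    have hd : hC.d s = 0 := Subtype.ext (hC.isHodge.d_H hs)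
    exact ⟨⟨s, hC.isHodge.H_le k hs, rfl⟩, (hπ.d_apply hC s).trans (by rw [hd, map_zero])⟩
  · rw [Submodule.disjoint_def]
    rintro _ ⟨q, -, rfl⟩ ⟨s, hs, hsq⟩
    obtain ⟨t, rfl⟩ := hπ.surjective q
    have hst : π s = π (hC.d t) := hsq.trans (hπ.d_apply hC t)
    have hs0 : s = 0 := by
      refine Subtype.ext (hC.isHodge.eq_zero_of_intg hC.isDminus hs fun u hu => ?_)
      have h := hπ.intg_mul_apply s ⟨u, hC.H_le hu⟩
      rw [hst, hπ.intg_mul_apply] at h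
      exact h.symm.trans (P.intg_d_mul_eq_zero (hC.isHodge.H_le_Zc _ hu) _)
    rw [← hsq, hs0]
    exact map_zero π
  · rintro _ ⟨⟨s, hs, rfl⟩, hds⟩
    have hds' : π (hC.d s) = 0 := (hπ.d_apply hC s).symm.trans hds
    refine Submodule.mem_sup.2 ⟨π (hC.d (hC.dminus s)), ⟨π (hC.dminus s),
      ⟨hC.dminus s, hC.isHodge.dm_mem hC.isDminus hs, rfl⟩, hπ.d_apply hC _⟩,
      π (hC.harm s), ⟨_, hC.harm_mem hs, rfl⟩, ?_⟩
    have h := congrArg π (hC.eq_add_harm s)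
    rw [map_add, map_add, hπ.map_dminus_eq_zero hC hds', add_zero] at h
    exact h.symm
  · rintro k _ ⟨s, hs, rfl⟩
    exact ⟨s, hC.isHodge.2.1 k hs, rfl⟩
  · intro k
    rw [Submodule.disjoint_def]
    rintro _ hx ⟨s, hs, rfl⟩
    obtain ⟨_, ⟨q, -, rfl⟩, _, ⟨h, hh, rfl⟩, hsum⟩ := Submodule.mem_sup.1 hx
    obtain ⟨t, rfl⟩ := hπ.surjective q
    have hs' : π s = π (hC.d t + h) := by
      rw [map_add, ← hπ.d_apply]; exact hsum.symm
    have h0 : hC.d (hC.d t + h) = 0 := Subtype.ext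
      (by rw [hC.coe_d, Subalgebra.coe_add, map_add, hC.coe_d, P.d_d, zero_add]
          exact hC.isHodge.d_H hh)
    have h1 : π (hC.d (s - (hC.d t + h))) = 0 :=
      hπ.map_d_eq_zero hC (by rw [map_sub, hs', sub_self])
    rw [map_sub, h0, sub_zero] at h1
    have h2 : hC.dminus (hC.d s) = s := Subtype.ext (hC.isDminus.1 k s hs)
    have h3 := hπ.map_dminus_eq_zero hC h1
    rwa [h2] at h3
  · rintro k _ ⟨s, hs, rfl⟩
    refine Submodule.mem_sup.2 ⟨π (hC.d (hC.dminus s)) + π (hC.harm s), ?_,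
      π (hC.dminus (hC.d s)), ⟨_, ?_, rfl⟩, ?_⟩
    · exact add_mem (Submodule.mem_sup_left ⟨π (hC.dminus s),
        ⟨hC.dminus s, hC.isHodge.dm_mem hC.isDminus hs, rfl⟩, hπ.d_apply hC _⟩)
        (Submodule.mem_sup_right ⟨_, hC.harm_mem hs, rfl⟩)
    · have h := hC.isDminus.2.2.2 (k + 1) (P.d s) (P.d_mem hs)
      rwa [add_sub_cancel_right] at h
    · rw [← map_add, ← map_add]
      exact congrArg π (hC.eq_add_harm s).symm
  · rintro j k a ha _ ⟨t, ht, rfl⟩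
    obtain ⟨_, ⟨s, hs, rfl⟩, _, ⟨s', hs', rfl⟩, rfl⟩ := Submodule.mem_sup.1 ha
    have h := hπ.intg_mul_apply (s + s') t
    rw [map_add] at h
    exact h.trans (hC.isHodge.intg_mul_B (add_mem (Submodule.mem_sup_left hs)
      (Submodule.mem_sup_right hs')) ht)

/-- In a degree `k` such that `C` is harmonic in degree `k` or `n - k`, the quotient is
harmonic. -/
theorem grading_eq (hπ : P.IsNullQuotient π) (hC : P.IsGradedHSubalgebra H B dm C) {k : ℤ}
    (hk : P.part C k ≤ H k ∨ P.part C (n - k) ≤ H (n - k)) :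
    mapFamily π P.grading k = mapFamily π H k := by
  refine le_antisymm ?_ ?_
  · rintro _ ⟨s, hs, rfl⟩
    rcases hk with hk | hk
    · exact ⟨s, hk ⟨s.2, hs⟩, rfl⟩
    · refine ⟨hC.harm s, hC.harm_mem hs, ?_⟩
      have h0 : π (hC.harm s - s) = 0 := by
        refine hπ.eq_zero_of_part hC fun j t ht => ?_
        have hks : ((hC.harm s - s : C) : A) ∈ P.grading k :=
          sub_mem (hC.isHodge.H_le k (hC.harm_mem hs)) hs
        by_cases hj : k + j = n
        · obtain rfl : j = n - k := by omega
          have ht' := hk ht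
          have h1 : P.intg (P.d (dm s) * t) = 0 :=
            P.intg_d_mul_eq_zero (hC.isHodge.H_le_Zc _ ht') _
          have h2 : P.intg (dm (P.d s) * t) = 0 :=
            hC.isHodge.intg_B_mul (Submodule.mem_sup_left ht')
              (hC.isDminus.2.2.2 _ _ (P.d_mem hs))
          change P.intg ((s - P.d (dm s) - dm (P.d s) - s) * t) = 0
          simp only [sub_mul, map_sub, h1, h2, sub_zero, sub_self]
        · exact P.intg_mul_eq_zero hks ht.2 hj
      rw [map_sub, sub_eq_zero] at h0
      exact h0
  · rintro _ ⟨s, hs, rfl⟩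
    exact ⟨s, hC.isHodge.H_le k hs, rfl⟩

end IsNullQuotient

end PoincareDGCA

namespace PoincareDGCA

variable {n : ℤ} {P : PoincareDGCA F A n} {H B : ℤ → Submodule F A} {dm : A →ₗ[F] A}
  {C : Subalgebra F A}

/-- The inclusion of a graded `H*`-subalgebra as a morphism of DGCAs. -/
def IsGradedHSubalgebra.inclusion (hC : P.IsGradedHSubalgebra H B dm C) :
    DGCAHom (BDGCA.mk C hC.toDGCA) (BDGCA.mk A P.toDGCA) where
  f := C.val
  map_grading _ _ ha := ha
  map_d _ := rfl

theorem IsGradedHSubalgebra.quasiIso_inclusion (hC : P.IsGradedHSubalgebra H B dm C) :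
    hC.inclusion.QuasiIso := by
  refine ⟨?_, ?_⟩
  · rintro i (a : C) - - ⟨b, hb⟩
    have hb' : (a : A) = P.d b := hb
    refine ⟨hC.dminus a, Subtype.ext ?_⟩
    change (a : A) = P.d (dm a)
    rw [hb', hC.isHodge.d_dm_d hC.isDminus]
  · intro i a ha hda
    have hh := hC.isHodge.sub_sub_mem_H hC.isDminus ha
    refine ⟨⟨_, hC.H_le hh⟩, hC.isHodge.H_le _ hh, Subtype.ext (hC.isHodge.d_H hh), -dm a, ?_⟩
    have hda' : P.d a = 0 := hda
    change a - P.d (dm a) - dm (P.d a) - a = P.d (-dm a)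
    rw [hda', map_zero, map_neg]
    abel

variable {Q : Type v} [Ring Q] [Algebra F Q] {π : C →ₐ[F] Q}

/-- The projection to the quotient by the null space as a morphism of DGCAs. -/
def IsNullQuotient.projection (hπ : P.IsNullQuotient π)
    (hC : P.IsGradedHSubalgebra H B dm C) :
    DGCAHom (BDGCA.mk C hC.toDGCA) (BDGCA.mk Q (hπ.toDGCA hC)) where
  f := π
  map_grading _ a ha := ⟨a, ha, rfl⟩
  map_d a := (hπ.d_apply hC a).symm

theorem IsNullQuotient.quasiIso_projection (hπ : P.IsNullQuotient π)
    (hC : P.IsGradedHSubalgebra H B dm C) : (hπ.projection hC).QuasiIso := by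
  refine ⟨?_, ?_⟩
  · rintro i (s : C) hs hds ⟨b, hb⟩
    obtain ⟨t, rfl⟩ := hπ.surjective b
    have hb' : π s = π (hC.d t) := hb.trans (hπ.d_apply hC t)
    have hds' : hC.d s = 0 := hds
    have hz : hC.harm (s - hC.d t) = hC.harm s := by
      have h1 : hC.d (hC.d t) = 0 := Subtype.ext (P.d_d t)
      have h2 : hC.d (hC.dminus (hC.d t)) = hC.d t :=
        Subtype.ext (hC.isHodge.d_dm_d hC.isDminus t)
      simp only [IsGradedHSubalgebra.harm, map_sub, h1, h2, sub_zero]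
      abel
    have h0 : π (hC.harm (s - hC.d t)) = 0 := by
      have h3 : π (s - hC.d t) = 0 := by rw [map_sub, hb', sub_self]
      rw [IsGradedHSubalgebra.harm, map_sub, map_sub, h3,
        hπ.map_d_eq_zero hC (hπ.map_dminus_eq_zero hC h3),
        hπ.map_dminus_eq_zero hC (hπ.map_d_eq_zero hC h3), sub_zero, sub_zero]
    rw [hz] at h0
    have h4 := hC.eq_add_harm s
    rw [hπ.eq_zero_of_mem_H hC (hC.harm_mem hs) h0, hds', map_zero, add_zero, add_zero] at h4
    exact ⟨hC.dminus s, h4⟩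
  · rintro i _ ⟨s, hs, rfl⟩ hds
    have hds' : π (hC.d s) = 0 := (hπ.d_apply hC s).symm.trans hds
    refine ⟨hC.harm s, hC.isHodge.H_le _ (hC.harm_mem hs),
      Subtype.ext (hC.isHodge.d_H (hC.harm_mem hs)), π (-hC.dminus s), ?_⟩
    refine Eq.trans ?_ (hπ.d_apply hC _).symm
    change π (hC.harm s) - π s = π (hC.d (-hC.dminus s))
    rw [IsGradedHSubalgebra.harm, map_sub, map_sub, hπ.map_dminus_eq_zero hC hds', map_neg, map_neg]
    abel

theorem IsHodge.isGradedHSubalgebra_smallAlgebra {r : ℤ} (hP : P.IsHodge H B)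
    (hdm : P.IsDminus H B dm) (hr : 1 < r) (hconn : P.RConnected (r - 1)) :
    P.IsGradedHSubalgebra H B dm (smallAlgebra P.toDGA H dm) :=
  ⟨hP, hdm, P.isHSubalgebra_smallAlgebra H dm, hP.smallAlgebra_eq_iSup_part hdm hr hconn⟩

end PoincareDGCA

/-- An `(r-1)`-connected (`r > 1`) Poincaré DGCA `A*` of degree `n` of
Hodge type with adapted harmonic subspace is equivalent to its small quotient algebra
`Q*_small = A*_small/(A*_small)⊥`, a finite dimensional nondegenerate Poincaré DGCA of
degree `n` of Hodge type (both the inclusion `A*_small ↪ A*` and the projection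
`A*_small → Q*_small` being quasi-isomorphisms); moreover `Qᵏ_small` equals its harmonic
subspace (the image of `Hᵏ`) for `0 ≤ k ≤ 2r-2` and `n-2r+2 ≤ k ≤ n`, and also for
`k = 2r-1` and `k = n-2r+1` if the multiplication `H^r ⊙ H^r → H^{2r}` is injective. -/
theorem statement_7 {n : ℤ} (P : PoincareDGCA F A n) (r : ℤ) (hr : 1 < r)
    (hconn : P.toDGA.RConnected (r - 1))
    (H B : ℤ → Submodule F A) (hHodge : P.IsHodge H B)
    (dm : A →ₗ[F] A) (hdm : P.toDGA.IsDminus H B dm)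
    (hadapted : ∃ G : ℤ → Submodule F A,
      IsGeneratingFamily P.toDGA G ∧ IsAdaptedHarmonic P.toDGA G H) :
    ∃ (S Q : BDGCA.{u, v} F) (ι : DGCAHom S (BDGCA.mk A P.toDGCA))
      (π : DGCAHom S Q) (PQ : PoincareDGCA F Q.carrier n),
      PQ.toDGCA = Q.str ∧
      -- `ι` identifies `S` with the small algebra `A*_small ⊆ A*`
      Function.Injective ι.f ∧
      (∀ a : A, a ∈ smallAlgebra P.toDGA H dm ↔ ∃ s, ι.f s = a) ∧
      -- the inclusion `A*_small ↪ A*` is a quasi-isomorphism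
      ι.QuasiIso ∧
      -- `π` is the projection onto the quotient by the null space of the pairing
      Function.Surjective π.f ∧
      (∀ s, π.f s = 0 ↔ ∀ t, P.intg (ι.f s * ι.f t) = 0) ∧
      -- the projection `A*_small → Q*_small` is a quasi-isomorphism
      π.QuasiIso ∧
      -- `Q*_small` is finite dimensional, nondegenerate, of Hodge type,
      -- and `A*` is equivalent to it
      FiniteDimensional F Q.carrier ∧
      PQ.perp = ⊥ ∧
      PQ.HodgeType ∧
      DGCAEquivalent (BDGCA.mk A P.toDGCA) Q ∧
      -- `Qᵏ_small` equals its harmonic subspace, the image of `Hᵏ`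
      (∀ k : ℤ, ((0 ≤ k ∧ k ≤ 2 * r - 2) ∨ (n - 2 * r + 2 ≤ k ∧ k ≤ n)) →
        Q.str.grading k =
          Submodule.map π.f.toLinearMap (Submodule.comap ι.f.toLinearMap (H k))) ∧
      -- the same in degrees `2r-1` and `n-2r+1` if `H^r ⊙ H^r → H^{2r}` is injective
      ((∀ t : H r ⊗[F] H r, gradedFlip r (H r) t = t →
          P.toDGA.IsExact (mulTensor (H r) t) → t = 0) →
        ∀ k : ℤ, (k = 2 * r - 1 ∨ k = n - 2 * r + 1) →
          Q.str.grading k =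
            Submodule.map π.f.toLinearMap (Submodule.comap ι.f.toLinearMap (H k))) := by
  obtain ⟨G, hG, hGH⟩ := hadapted
  have hC := hHodge.isGradedHSubalgebra_smallAlgebra hdm hr hconn
  have hfinS := hHodge.finiteDimensional_smallAlgebra hdm hr hconn
  obtain ⟨Q, _, _, π, hπ⟩ := hC.exists_nullQuotient
  have hfin : FiniteDimensional F Q := Module.Finite.of_surjective π.toLinearMap hπ.surjective
  refine ⟨_, _, hC.inclusion, hπ.projection hC, hπ.toPoincareDGCA hC hfin, rfl,
    Subtype.val_injective, fun a => ⟨fun ha => ⟨⟨a, ha⟩, rfl⟩, ?_⟩, hC.quasiIso_inclusion,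
    hπ.surjective, hπ.eq_zero_iff, hπ.quasiIso_projection hC, hfin, hπ.perp_eq_bot hC hfin,
    ⟨_, _, hπ.isHodge hC hfin⟩, ?_, fun k hk => hπ.grading_eq hC ?_,
    fun hinj k hk => hπ.grading_eq hC ?_⟩
  · rintro ⟨s, rfl⟩
    exact s.2
  · exact Relation.EqvGen.trans _ _ _
      (Relation.EqvGen.symm _ _ (Relation.EqvGen.rel _ _ ⟨_, hC.quasiIso_inclusion⟩))
      (Relation.EqvGen.rel _ _ ⟨_, hπ.quasiIso_projection hC⟩)
  · exact hk.imp (fun h => hHodge.part_smallAlgebra_le_H hdm hr hconn h.2)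
      fun h => hHodge.part_smallAlgebra_le_H hdm hr hconn (by omega)
  · have h := hHodge.part_smallAlgebra_le_H_of_injective hdm hr hconn hG hGH hinj
    rcases hk with rfl | rfl
    · exact Or.inl h
    · right
      rwa [show n - (n - 2 * r + 1) = 2 * r - 1 by ring]
end

section
/- Let A* be an (r−1)-connected (r > 1) Poincaré DGCA of degree n of Hodge type. Then A* is equivalent to a finite-dimensional nondegenerate Poincaré DGCA Q* of degree n for which the differential d : Q^{k−1} → Q^k is possibly nonzero only for 2r ≤ k ≤ n−2r+1. In particular: (1) if n ≤ 4r−2, then A* is formal; (2) if n = 4r−1, then d : Q^{k−1} → Q^k vanishes for all k ≠ 2r. -/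
universe u v

open scoped TensorProduct

/-- A family of submodules admitting projections is an internal direct sum once it spans. -/
theorem isInternal_of_projections {F ι M : Type*} [DecidableEq ι] [Field F] [AddCommGroup M]
    [Module F M] (G : ι → Submodule F M) (π : ι → M →ₗ[F] M)
    (hπ : ∀ k, ∀ a ∈ G k, π k a = a) (hπ' : ∀ j k, j ≠ k → ∀ a ∈ G j, π k a = 0)
    (htop : iSup G = ⊤) : DirectSum.IsInternal G := by
  refine (DirectSum.isInternal_submodule_iff_iSupIndep_and_iSup_eq_top G).2
    ⟨iSupIndep_def.2 fun i => Submodule.disjoint_def.2 fun x hx hx' => ?_, htop⟩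
  have hle : (⨆ (j) (_ : j ≠ i), G j) ≤ LinearMap.ker (π i) :=
    iSup₂_le fun j hj a ha => hπ' j i hj a ha
  rw [← hπ i x hx]
  exact hle hx'

namespace DGA

variable {F : Type u} {A : Type v} [Field F] [Ring A] [Algebra F A] (D : DGA F A)

theorem exists_proj : ∃ π : ℤ → A →ₗ[F] A, (∀ k, ∀ a ∈ D.grading k, π k a = a) ∧
    (∀ j k, j ≠ k → ∀ a ∈ D.grading j, π k a = 0) ∧ (∀ k a, π k a ∈ D.grading k) ∧
    ∀ a, ∃ s : Finset ℤ, ∑ k ∈ s, π k a = a := by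
  let := D.internal.chooseDecomposition
  refine ⟨fun k => (D.grading k).subtype ∘ₗ DirectSum.component F ℤ _ k ∘ₗ
    (DirectSum.decomposeLinearEquiv D.grading).toLinearMap, ?_, ?_, ?_, ?_⟩
  · intro k a ha
    exact DirectSum.decompose_of_mem_same D.grading ha
  · intro j k hjk a ha
    exact DirectSum.decompose_of_mem_ne D.grading ha hjk
  · intro k a
    exact Subtype.property _
  · intro a
    classical exact ⟨_, DirectSum.sum_support_decompose D.grading a⟩

/-- The projection onto the homogeneous component of degree `k`. -/
noncomputable def proj (k : ℤ) : A →ₗ[F] A := D.exists_proj.choose k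

variable {D}

theorem proj_of_mem {k : ℤ} {a : A} (ha : a ∈ D.grading k) : D.proj k a = a :=
  D.exists_proj.choose_spec.1 k a ha

theorem proj_of_mem_ne {j k : ℤ} {a : A} (ha : a ∈ D.grading j) (h : j ≠ k) :
    D.proj k a = 0 :=
  D.exists_proj.choose_spec.2.1 j k h a ha

variable (D)

theorem proj_mem (k : ℤ) (a : A) : D.proj k a ∈ D.grading k :=
  D.exists_proj.choose_spec.2.2.1 k a

theorem iSup_grading_s8 : iSup D.grading = ⊤ :=
  ((DirectSum.isInternal_submodule_iff_iSupIndep_and_iSup_eq_top _).1 D.internal).2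

variable {D}

theorem homogeneous_induction_s8 {p : A → Prop} (a : A) (h : ∀ k, ∀ a ∈ D.grading k, p a)
    (h0 : p 0) (hadd : ∀ a b, p a → p b → p (a + b)) : p a := by
  have ha : a ∈ iSup D.grading := by simp [iSup_grading_s8]
  exact Submodule.iSup_induction (motive := p) D.grading ha h h0 hadd

theorem mem_of_proj_mem {N : Submodule F A} {a : A} (h : ∀ k, D.proj k a ∈ N) : a ∈ N := by
  obtain ⟨s, hs⟩ := D.exists_proj.choose_spec.2.2.2 a
  rw [← hs]
  exact sum_mem fun k _ => h k

theorem proj_d (k : ℤ) (a : A) : D.proj (k + 1) (D.d a) = D.d (D.proj k a) := by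
  induction a using D.homogeneous_induction_s8 with
  | h j a ha =>
    by_cases hjk : j = k
    · subst hjk
      rw [proj_of_mem ha, proj_of_mem (D.d_mem ha)]
    · rw [proj_of_mem_ne ha hjk, proj_of_mem_ne (D.d_mem ha) (by omega), map_zero]
  | h0 => simp
  | hadd a b ha hb => simp only [map_add, ha, hb]

/-- A homogeneous exact element is the differential of a homogeneous element. -/
theorem mem_Bc_of_exact {k : ℤ} {a b : A} (ha : a ∈ D.grading k) (h : a = D.d b) :
    a ∈ D.Bc k := by
  refine ⟨D.proj (k - 1) b, D.proj_mem _ _, ?_⟩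
  rw [← proj_d, ← h, sub_add_cancel, proj_of_mem ha]

variable (D)

/-- A graded family of subspaces closed under the DGA operations. -/
structure IsSubfamily (S : ℤ → Submodule F A) : Prop where
  le : ∀ k, S k ≤ D.grading k
  one : (1 : A) ∈ S 0
  mul : ∀ {i j : ℤ} {a b : A}, a ∈ S i → b ∈ S j → a * b ∈ S (i + j)
  d : ∀ {i : ℤ} {a : A}, a ∈ S i → D.d a ∈ S (i + 1)

namespace IsSubfamily

variable {D} {S : ℤ → Submodule F A} (h : D.IsSubfamily S)
include h

theorem mul_mem_iSup {a b : A} (ha : a ∈ iSup S) (hb : b ∈ iSup S) : a * b ∈ iSup S := by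
  induction ha using Submodule.iSup_induction' with
  | mem i a ha =>
    induction hb using Submodule.iSup_induction' with
    | mem j b hb => exact Submodule.mem_iSup_of_mem _ (h.mul ha hb)
    | zero => simp
    | add x y _ _ hx hy => rw [mul_add]; exact add_mem hx hy
  | zero => simp
  | add x y _ _ hx hy => rw [add_mul]; exact add_mem hx hy

theorem d_mem_iSup {a : A} (ha : a ∈ iSup S) : D.d a ∈ iSup S := by
  induction ha using Submodule.iSup_induction' with
  | mem i a ha => exact Submodule.mem_iSup_of_mem _ (h.d ha)
  | zero => simp
  | add x y _ _ hx hy => rw [map_add]; exact add_mem hx hy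

theorem proj_mem {a : A} (ha : a ∈ iSup S) (k : ℤ) : D.proj k a ∈ S k := by
  induction ha using Submodule.iSup_induction' with
  | mem i a ha =>
    by_cases hik : i = k
    · subst hik
      rwa [proj_of_mem (h.le _ ha)]
    · simp [proj_of_mem_ne (h.le _ ha) hik]
  | zero => simp
  | add x y _ _ hx hy => rw [map_add]; exact add_mem hx hy

/-- The subalgebra spanned by a subfamily. -/
def total : Subalgebra F A :=
  (iSup S).toSubalgebra (Submodule.mem_iSup_of_mem 0 h.one) fun _ _ => h.mul_mem_iSup

theorem mem_total_of_mem {k : ℤ} {a : A} (ha : a ∈ S k) : a ∈ h.total :=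
  Submodule.mem_iSup_of_mem (p := S) k ha

/-- The DGA structure on the subalgebra spanned by a subfamily. -/
def toDGA : DGA F h.total where
  grading k := (S k).comap h.total.val.toLinearMap
  internal := by
    refine isInternal_of_projections _
      (fun k => (D.proj k ∘ₗ h.total.val.toLinearMap).codRestrict
        (Subalgebra.toSubmodule h.total) fun a => h.mem_total_of_mem (h.proj_mem a.2 k))
      ?_ ?_ ?_
    · intro k a ha
      exact Subtype.ext (proj_of_mem (h.le _ ha))
    · intro j k hjk a ha
      exact Subtype.ext (proj_of_mem_ne (h.le _ ha) hjk)
    · refine eq_top_iff.2 ?_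
      rintro ⟨a, ha⟩ -
      change a ∈ iSup S at ha
      induction ha using Submodule.iSup_induction' with
      | mem i a ha => exact Submodule.mem_iSup_of_mem i ha
      | zero => exact Submodule.zero_mem _
      | add x y _ _ hx hy => exact add_mem hx hy
  nonneg i hi := by
    refine eq_bot_iff.2 fun a ha => Subtype.ext ?_
    simpa [D.nonneg i hi] using h.le _ ha
  one_mem := h.one
  mul_mem ha hb := h.mul ha hb
  d := (D.d ∘ₗ h.total.val.toLinearMap).codRestrict
    (Subalgebra.toSubmodule h.total) fun a => h.d_mem_iSup a.2
  d_mem ha := h.d ha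
  d_d a := Subtype.ext (D.d_d a)
  leibniz a b ha := Subtype.ext (D.leibniz (a : A) b (h.le _ ha))

end IsSubfamily

end DGA

/-- The DGCA structure on the subalgebra spanned by a subfamily. -/
def DGA.IsSubfamily.toDGCA {F : Type u} {A : Type v} [Field F] [Ring A] [Algebra F A]
    {D : DGCA F A} {S : ℤ → Submodule F A} (h : D.toDGA.IsSubfamily S) : DGCA F h.total where
  toDGA := h.toDGA
  gcomm a b ha hb := Subtype.ext (D.gcomm (a : A) b (h.le _ ha) (h.le _ hb))

namespace Ideal.Quotient

variable {F A M : Type*} [Field F] [Ring A] [Algebra F A] [AddCommGroup M] [Module F M]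

/-- The linear map induced on `A ⧸ I` by a linear map vanishing on `I`. -/
def liftLinear (I : Ideal A) [I.IsTwoSided] (f : A →ₗ[F] M) (hf : ∀ a ∈ I, f a = 0) :
    A ⧸ I →ₗ[F] M :=
  (I.restrictScalars F).liftQ f hf ∘ₗ
    (Submodule.Quotient.restrictScalarsEquiv F I).symm.toLinearMap

end Ideal.Quotient

/-- The quotient of a DGA by a two-sided differential graded ideal. -/
def DGA.quotient {F : Type u} {A : Type v} [Field F] [Ring A] [Algebra F A] (D : DGA F A)
    (I : Ideal A) [I.IsTwoSided] (hproj : ∀ k, ∀ a ∈ I, D.proj k a ∈ I)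
    (hd : ∀ a ∈ I, D.d a ∈ I) : DGA F (A ⧸ I) where
  grading k := (D.grading k).map (Ideal.Quotient.mkₐ F I).toLinearMap
  internal := by
    refine isInternal_of_projections _
      (fun k => Ideal.Quotient.liftLinear I
        ((Ideal.Quotient.mkₐ F I).toLinearMap ∘ₗ D.proj k)
        fun a ha => Ideal.Quotient.eq_zero_iff_mem.2 (hproj k a ha)) ?_ ?_ ?_
    · rintro k _ ⟨a, ha, rfl⟩
      exact congrArg (Ideal.Quotient.mkₐ F I) (DGA.proj_of_mem ha)
    · rintro j k hjk _ ⟨a, ha, rfl⟩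
      exact (congrArg (Ideal.Quotient.mkₐ F I) (DGA.proj_of_mem_ne ha hjk)).trans (map_zero _)
    · rw [← Submodule.map_iSup, D.iSup_grading_s8, Submodule.map_top, LinearMap.range_eq_top]
      exact Ideal.Quotient.mkₐ_surjective F I
  nonneg i hi := by rw [D.nonneg i hi, Submodule.map_bot]
  one_mem := ⟨1, D.one_mem, map_one (Ideal.Quotient.mkₐ F I)⟩
  mul_mem := by
    rintro i j _ _ ⟨a, ha, rfl⟩ ⟨b, hb, rfl⟩
    exact ⟨a * b, D.mul_mem ha hb, map_mul (Ideal.Quotient.mkₐ F I) a b⟩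
  d := Ideal.Quotient.liftLinear I ((Ideal.Quotient.mkₐ F I).toLinearMap ∘ₗ D.d)
    fun a ha => Ideal.Quotient.eq_zero_iff_mem.2 (hd a ha)
  d_mem := by
    rintro i _ ⟨a, ha, rfl⟩
    exact ⟨D.d a, D.d_mem ha, rfl⟩
  d_d a := by
    obtain ⟨a, rfl⟩ := Ideal.Quotient.mkₐ_surjective F I a
    exact (congrArg (Ideal.Quotient.mkₐ F I) (D.d_d a)).trans (map_zero _)
  leibniz := by
    rintro i _ b ⟨a, ha, rfl⟩
    obtain ⟨b, rfl⟩ := Ideal.Quotient.mkₐ_surjective F I b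
    refine (congrArg (Ideal.Quotient.mkₐ F I) (D.leibniz a b ha)).trans ?_
    simp only [map_add, map_mul, map_smul]
    rfl

/-- The quotient of a DGCA by a two-sided differential graded ideal. -/
def DGCA.quotient {F : Type u} {A : Type v} [Field F] [Ring A] [Algebra F A] (D : DGCA F A)
    (I : Ideal A) [I.IsTwoSided] (hproj : ∀ k, ∀ a ∈ I, D.proj k a ∈ I)
    (hd : ∀ a ∈ I, D.d a ∈ I) : DGCA F (A ⧸ I) where
  toDGA := D.toDGA.quotient I hproj hd
  gcomm := by
    rintro i j _ _ ⟨a, ha, rfl⟩ ⟨b, hb, rfl⟩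
    refine (congrArg (Ideal.Quotient.mkₐ F I) (D.gcomm a b ha hb)).trans ?_
    simp only [map_mul, map_smul]
    rfl

namespace PoincareDGCA

variable {F : Type u} {A : Type v} [Field F] [Ring A] [Algebra F A] {n : ℤ}
  {P : PoincareDGCA F A n}

theorem intg_mul_of_ne {i j : ℤ} {a b : A} (ha : a ∈ P.grading i) (hb : b ∈ P.grading j)
    (h : i + j ≠ n) : P.intg (a * b) = 0 :=
  P.intg_deg _ h _ (P.mul_mem ha hb)

theorem intg_mul_comm_eq_zero {i j : ℤ} {a b : A} (ha : a ∈ P.grading i)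
    (hb : b ∈ P.grading j) (h : P.intg (b * a) = 0) : P.intg (a * b) = 0 := by
  rw [P.gcomm a b ha hb, map_smul, h, smul_zero]

theorem intg_d_mul {i : ℤ} {a : A} (ha : a ∈ P.grading i) (b : A) :
    P.intg (P.d a * b) = -((-1 : F) ^ i • P.intg (a * P.d b)) := by
  have h := P.intg_d (a * b)
  rw [P.leibniz a b ha, map_add, map_smul] at h
  exact eq_neg_of_add_eq_zero_left h

theorem intg_mul_d_eq_zero {i : ℤ} {a b : A} (ha : a ∈ P.grading i)
    (h : P.intg (P.d a * b) = 0) : P.intg (a * P.d b) = 0 := by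
  rw [intg_d_mul ha, neg_eq_zero, smul_eq_zero] at h
  exact h.resolve_left (zpow_ne_zero _ (neg_ne_zero.2 one_ne_zero))

theorem intg_mul_d_of_cocycle {i : ℤ} {a : A} (ha : a ∈ P.grading i) (hd : P.d a = 0) (b : A) :
    P.intg (a * P.d b) = 0 :=
  intg_mul_d_eq_zero ha (by simp [hd])

theorem mem_perp {a : A} : a ∈ P.perp ↔ ∀ b, P.intg (a * b) = 0 := by
  simp [perp]

theorem mem_perp_of_homogeneous {k : ℤ} {a : A} (ha : a ∈ P.grading k)
    (h : ∀ b ∈ P.grading (n - k), P.intg (a * b) = 0) : a ∈ P.perp := by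
  refine mem_perp.2 fun b => ?_
  induction b using P.homogeneous_induction_s8 with
  | h j b hb =>
    by_cases hj : k + j = n
    · exact h b ((show n - k = j by omega) ▸ hb)
    · exact intg_mul_of_ne ha hb hj
  | h0 => simp
  | hadd x y hx hy => rw [mul_add, map_add, hx, hy, add_zero]

theorem proj_mem_perp {a : A} (ha : a ∈ P.perp) (k : ℤ) : P.proj k a ∈ P.perp := by
  refine mem_perp_of_homogeneous (P.proj_mem k a) fun b hb => ?_
  rw [← mem_perp.1 ha b]
  clear ha
  induction a using P.homogeneous_induction_s8 with
  | h j a ha =>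
    by_cases hj : j = k
    · subst hj
      rw [DGA.proj_of_mem ha]
    · rw [DGA.proj_of_mem_ne ha hj, zero_mul, map_zero,
        intg_mul_of_ne ha hb (by omega)]
  | h0 => simp
  | hadd x y hx hy => simp only [map_add, add_mul, hx, hy]

theorem mul_mem_perp_right {a : A} (ha : a ∈ P.perp) (b : A) : a * b ∈ P.perp :=
  mem_perp.2 fun c => by rw [mul_assoc]; exact mem_perp.1 ha _

theorem mul_mem_perp_left {a : A} (ha : a ∈ P.perp) (b : A) : b * a ∈ P.perp := by
  induction b using P.homogeneous_induction_s8 with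
  | h j b hb =>
    refine DGA.mem_of_proj_mem (D := P.toDGA) (N := P.perp.comap (LinearMap.mulLeft F b))
      fun k => ?_
    change b * P.proj k a ∈ P.perp
    rw [P.gcomm b _ hb (P.proj_mem k a)]
    exact Submodule.smul_mem _ _ (mul_mem_perp_right (proj_mem_perp ha k) b)
  | h0 => simp
  | hadd x y hx hy => rw [add_mul]; exact add_mem hx hy

theorem d_mem_perp {a : A} (ha : a ∈ P.perp) : P.d a ∈ P.perp := by
  refine DGA.mem_of_proj_mem (D := P.toDGA) (N := P.perp.comap P.d) fun k => ?_
  refine mem_perp.2 fun b => ?_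
  rw [intg_d_mul (P.proj_mem k a), mem_perp.1 (proj_mem_perp ha k), smul_zero, neg_zero]

theorem intg_d_mul_of_cocycle {b : A} (hd : P.d b = 0) (a : A) :
    P.intg (P.d a * b) = 0 := by
  induction a using P.homogeneous_induction_s8 with
  | h i a ha => rw [intg_d_mul ha, hd, mul_zero, map_zero, smul_zero, neg_zero]
  | h0 => simp
  | hadd x y hx hy => rw [map_add, add_mul, map_add, hx, hy, add_zero]

namespace IsHodge

variable {H B : ℤ → Submodule F A} (h : P.IsHodge H B)
include h

theorem harmonic_mem {k : ℤ} {a : A} (ha : a ∈ H k) : a ∈ P.grading k := ((h.1 k).1 ha).1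

theorem harmonic_d {k : ℤ} {a : A} (ha : a ∈ H k) : P.d a = 0 := ((h.1 k).1 ha).2

theorem exists_of_cocycle {k : ℤ} {a : A} (ha : a ∈ P.grading k) (hd : P.d a = 0) :
    ∃ c ∈ P.grading (k - 1), ∃ x ∈ H k, P.d c + x = a := by
  obtain ⟨_, ⟨c, hc, rfl⟩, x, hx, hax⟩ := Submodule.mem_sup.1 ((h.1 k).2.2 ⟨ha, hd⟩)
  exact ⟨c, hc, x, hx, hax⟩

theorem exists_decomposition {k : ℤ} {a : A} (ha : a ∈ P.grading k) :
    ∃ c ∈ P.grading (k - 1), ∃ x ∈ H k, ∃ b ∈ B k, P.d c + x + b = a := by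
  obtain ⟨_, hy, b, hb, rfl⟩ := Submodule.mem_sup.1 (h.2.2.2.1 k ha)
  obtain ⟨_, ⟨c, hc, rfl⟩, x, hx, rfl⟩ := Submodule.mem_sup.1 hy
  exact ⟨c, hc, x, hx, b, hb, rfl⟩

theorem harmonic_eq_zero {k : ℤ} {x : A} (hx : x ∈ H k)
    (hx' : ∀ y ∈ H (n - k), P.intg (x * y) = 0) : x = 0 := by
  obtain ⟨c, hc⟩ := P.nondeg k x (h.harmonic_mem hx) (h.harmonic_d hx) fun b hb hdb => by
    obtain ⟨c, -, y, hy, rfl⟩ := h.exists_of_cocycle hb hdb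
    rw [mul_add, map_add, hx' y hy, add_zero]
    exact intg_mul_d_of_cocycle (h.harmonic_mem hx) (h.harmonic_d hx) c
  exact Submodule.disjoint_def.1 (h.1 k).2.1 x
    (DGA.mem_Bc_of_exact (h.harmonic_mem hx) hc) hx

theorem mem_perp_of_d_mem_perp {k : ℤ} {b : A} (hb : b ∈ B k) (hd : P.d b ∈ P.perp) :
    b ∈ P.perp := by
  have hb' := h.2.1 k hb
  refine mem_perp_of_homogeneous hb' fun y hy => ?_
  obtain ⟨c, hc, x, hx, b', hbb, rfl⟩ := h.exists_decomposition hy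
  rw [mul_add, mul_add, map_add, map_add, intg_mul_d_eq_zero hb' (mem_perp.1 hd c),
    intg_mul_comm_eq_zero hb' (h.harmonic_mem hx)
      (h.2.2.2.2 _ k x (Submodule.mem_sup_left hx) b hb),
    h.2.2.2.2 k _ b (Submodule.mem_sup_right hb) b' hbb, add_zero, add_zero]

theorem exists_of_d_mem_perp {k : ℤ} {a : A} (ha : a ∈ P.grading k) (hd : P.d a ∈ P.perp) :
    ∃ c ∈ P.grading (k - 1), ∃ x ∈ H k, ∃ b ∈ P.perp, P.d c + x + b = a := by
  obtain ⟨c, hc, x, hx, b, hb, rfl⟩ := h.exists_decomposition ha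
  refine ⟨c, hc, x, hx, b, h.mem_perp_of_d_mem_perp hb ?_, rfl⟩
  simpa [P.d_d, h.harmonic_d hx] using hd

end IsHodge

variable (P)

/-- The null space of the pairing, as an ideal. -/
def perpIdeal : Ideal A where
  toAddSubmonoid := P.perp.toAddSubmonoid
  smul_mem' b _ ha := mul_mem_perp_left ha b

variable {P}

theorem mem_perpIdeal {a : A} : a ∈ P.perpIdeal ↔ a ∈ P.perp := Iff.rfl

instance : P.perpIdeal.IsTwoSided := ⟨fun b ha => mul_mem_perp_right ha b⟩

variable (P)

/-- The projection onto the quotient by the null space. -/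
def perpMk : A →ₐ[F] A ⧸ P.perpIdeal := Ideal.Quotient.mkₐ F P.perpIdeal

variable {P}

theorem perpMk_surjective : Function.Surjective P.perpMk :=
  Ideal.Quotient.mkₐ_surjective F P.perpIdeal

theorem perpMk_eq_zero {a : A} : P.perpMk a = 0 ↔ a ∈ P.perp :=
  Ideal.Quotient.eq_zero_iff_mem

variable (P)

/-- The DGCA obtained from a Poincaré DGCA by dividing out the null space. -/
def reducedDGCA : DGCA F (A ⧸ P.perpIdeal) :=
  P.toDGCA.quotient P.perpIdeal (fun k _ ha => proj_mem_perp ha k) fun _ ha => d_mem_perp ha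

/-- The functional induced on the quotient by the null space. -/
def reducedIntg : A ⧸ P.perpIdeal →ₗ[F] F :=
  Ideal.Quotient.liftLinear P.perpIdeal P.intg fun a ha => by
    simpa using mem_perp.1 (mem_perpIdeal.1 ha) 1

variable {P}

theorem reducedDGCA_d_perpMk (a : A) : P.reducedDGCA.d (P.perpMk a) = P.perpMk (P.d a) := rfl

theorem reducedIntg_perpMk (a : A) : P.reducedIntg (P.perpMk a) = P.intg a := rfl

theorem perpMk_mem_grading {k : ℤ} {a : A} (ha : a ∈ P.grading k) :
    P.perpMk a ∈ P.reducedDGCA.grading k := ⟨a, ha, rfl⟩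

theorem exists_perpMk_eq {k : ℤ} {x : A ⧸ P.perpIdeal} (hx : x ∈ P.reducedDGCA.grading k) :
    ∃ a ∈ P.grading k, P.perpMk a = x := hx

instance [FiniteDimensional F A] : FiniteDimensional F (A ⧸ P.perpIdeal) :=
  Module.Finite.of_surjective P.perpMk.toLinearMap perpMk_surjective

/-- The quotient of a Poincaré DGCA of Hodge type by its null space. -/
def reduced [FiniteDimensional F A] (hP : P.HodgeType) :
    PoincareDGCA F (A ⧸ P.perpIdeal) n where
  toDGCA := P.reducedDGCA
  top i hi := by
    refine eq_bot_iff.2 fun x hx => ?_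
    obtain ⟨a, ha, rfl⟩ := exists_perpMk_eq hx
    rw [P.top i hi, Submodule.mem_bot] at ha
    simp [ha]
  fin_cohomology _ := ⟨⊤, inferInstance, fun a _ _ => ⟨a, trivial, 0, by simp⟩⟩
  intg := P.reducedIntg
  intg_deg i hi x hx := by
    obtain ⟨a, ha, rfl⟩ := exists_perpMk_eq hx
    exact P.intg_deg i hi a ha
  intg_d x := by
    obtain ⟨a, rfl⟩ := perpMk_surjective x
    exact P.intg_d a
  nondeg i x hx hdx hx' := by
    obtain ⟨H, B, h⟩ := hP
    obtain ⟨a, ha, rfl⟩ := exists_perpMk_eq hx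
    rw [reducedDGCA_d_perpMk, perpMk_eq_zero] at hdx
    obtain ⟨c, hc, y, hy, b, hb, rfl⟩ := h.exists_of_d_mem_perp ha hdx
    have hy0 : y = 0 := by
      refine h.harmonic_eq_zero hy fun z hz => ?_
      have hz' := hx' (P.perpMk z) (perpMk_mem_grading (h.harmonic_mem hz))
        (by rw [reducedDGCA_d_perpMk, h.harmonic_d hz, map_zero])
      rwa [← map_mul, reducedIntg_perpMk, add_mul, add_mul, map_add, map_add,
        intg_d_mul_of_cocycle (h.harmonic_d hz), mem_perp.1 hb, zero_add,
        add_zero] at hz'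
    refine ⟨P.perpMk c, ?_⟩
    rw [reducedDGCA_d_perpMk, map_add, map_add, hy0, map_zero, perpMk_eq_zero.2 hb, add_zero,
      add_zero]

theorem reduced_perp [FiniteDimensional F A] (hP : P.HodgeType) : (reduced hP).perp = ⊥ := by
  refine eq_bot_iff.2 fun x hx => ?_
  obtain ⟨a, rfl⟩ := perpMk_surjective x
  exact perpMk_eq_zero.2 (mem_perp.2 fun b => mem_perp.1 hx (P.perpMk b))

variable (P) in
/-- The projection onto the quotient by the null space, as a DGCA morphism. -/
def reducedHom : DGCAHom (BDGCA.mk A P.toDGCA) (BDGCA.mk (A ⧸ P.perpIdeal) P.reducedDGCA) where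
  f := P.perpMk
  map_grading _ _ ha := perpMk_mem_grading ha
  map_d _ := rfl

theorem reducedHom_quasiIso (hP : P.HodgeType) : P.reducedHom.QuasiIso := by
  obtain ⟨H, B, h⟩ := hP
  refine ⟨?_, ?_⟩
  · rintro i (a : A) ha hda ⟨x, hx⟩
    obtain ⟨b, rfl⟩ := perpMk_surjective x
    have hab : a - P.d b ∈ P.perp := by
      rw [← perpMk_eq_zero, map_sub, sub_eq_zero]
      exact hx
    obtain ⟨c, hc, y, hy, rfl⟩ := h.exists_of_cocycle ha hda
    have hy0 : y = 0 := by
      refine h.harmonic_eq_zero hy fun z hz => ?_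
      have hz' := mem_perp.1 hab z
      rwa [sub_mul, add_mul, map_sub, map_add,
        intg_d_mul_of_cocycle (h.harmonic_d hz),
        intg_d_mul_of_cocycle (h.harmonic_d hz), zero_add, sub_zero] at hz'
    exact ⟨c, by rw [hy0, add_zero]⟩
  · intro i x hx hdx
    obtain ⟨a, ha, rfl⟩ := exists_perpMk_eq hx
    have hda : P.d a ∈ P.perp := perpMk_eq_zero.1 hdx
    obtain ⟨c, hc, y, hy, b, hb, rfl⟩ := h.exists_of_d_mem_perp ha hda
    refine ⟨y, h.harmonic_mem hy, h.harmonic_d hy, P.perpMk (-c), ?_⟩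
    change P.perpMk y - P.perpMk (P.d c + y + b) = P.perpMk (P.d (-c))
    rw [map_add, perpMk_eq_zero.2 hb, map_neg, map_neg, map_add]
    abel

/-- If `d` vanishes on degree `n - k`, then dually the differential of the quotient by the null
space vanishes on degree `k - 1`. -/
theorem reducedDGCA_d_eq_zero {k : ℤ} (hk : ∀ b ∈ P.grading (n - k), P.d b = 0)
    {x : A ⧸ P.perpIdeal} (hx : x ∈ P.reducedDGCA.grading (k - 1)) : P.reducedDGCA.d x = 0 := by
  obtain ⟨a, ha, rfl⟩ := exists_perpMk_eq hx
  rw [reducedDGCA_d_perpMk, perpMk_eq_zero]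
  have hda := P.d_mem ha
  rw [sub_add_cancel] at hda
  exact mem_perp_of_homogeneous hda fun b hb => intg_d_mul_of_cocycle (hk b hb) a

end PoincareDGCA

namespace PoincareDGCA

variable {F : Type u} {A : Type v} [Field F] [Ring A] [Algebra F A] {n : ℤ}
  (P : PoincareDGCA F A n)

/-- A subfamily compatible with a Hodge type decomposition: it contains the harmonic subspace and
is closed under the operator `d⁻`. -/
structure IsHodgeSubfamily (H B S : ℤ → Submodule F A) : Prop extends
    P.toDGA.IsSubfamily S where
  harmonic_le : ∀ k, H k ≤ S k
  exists_decomposition : ∀ k, ∀ a ∈ S k, ∃ c ∈ S (k - 1), ∃ x ∈ H k, ∃ b ∈ B k,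
    P.d c + x + b = a

namespace IsHodgeSubfamily

variable {P} {H B S : ℤ → Submodule F A} (hS : P.IsHodgeSubfamily H B S)

/-- The inclusion of the DGCA spanned by a subfamily. -/
def inclusion : DGCAHom (BDGCA.mk hS.total hS.toIsSubfamily.toDGCA) (BDGCA.mk A P.toDGCA) where
  f := hS.total.val
  map_grading k _ ha := hS.le k ha
  map_d _ := rfl

include hS in
theorem finiteDimensional_total (hfg : ∀ k, (S k).FG) : FiniteDimensional F hS.total := by
  refine (Submodule.fg_iff_finiteDimensional (Subalgebra.toSubmodule hS.total)).1 ?_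
  change (iSup S).FG
  have hle : iSup S = ⨆ k : Set.Icc (0 : ℤ) n, S k := by
    refine le_antisymm (iSup_le fun k => ?_) (iSup_le fun k => le_iSup S k)
    by_cases hk : 0 ≤ k ∧ k ≤ n
    · exact le_iSup (fun k : Set.Icc (0 : ℤ) n => S k) ⟨k, hk⟩
    · refine (hS.le k).trans ?_
      rcases not_and_or.1 hk with hk | hk
      · rw [P.nonneg k (by omega)]; exact bot_le
      · rw [P.top k (by omega)]; exact bot_le
  rw [hle]
  exact Submodule.fg_iSup _ fun k => hfg k

variable (h : P.IsHodge H B)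
include hS h

theorem exists_of_cocycle {k : ℤ} {a : A} (ha : a ∈ S k) (hd : P.d a = 0) :
    ∃ c ∈ S (k - 1), ∃ x ∈ H k, P.d c + x = a := by
  obtain ⟨c, hc, x, hx, b, hb, rfl⟩ := hS.exists_decomposition k a ha
  refine ⟨c, hc, x, hx, ?_⟩
  have hdb : P.d b = 0 := by simpa [P.d_d, h.harmonic_d hx] using hd
  rw [Submodule.disjoint_def.1 (h.2.2.1 k) b ((h.1 k).2.2 ⟨h.2.1 k hb, hdb⟩) hb, add_zero]

theorem exists_of_exact {k : ℤ} {a c : A} (ha : a ∈ S k) (hc : a = P.d c) :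
    ∃ c' ∈ S (k - 1), a = P.d c' := by
  obtain ⟨c', hc', x, hx, hax⟩ := hS.exists_of_cocycle h ha (by rw [hc, P.d_d])
  have hx0 : x = 0 := Submodule.disjoint_def.1 (h.1 k).2.1 x
    (DGA.mem_Bc_of_exact (b := c - c') (h.harmonic_mem hx)
      (by rw [map_sub, ← hc, ← hax, add_sub_cancel_left])) hx
  exact ⟨c', hc', by rw [← hax, hx0, add_zero]⟩

/-- The Poincaré DGCA spanned by a subfamily compatible with a Hodge type decomposition. -/
def toPoincare [FiniteDimensional F hS.total] : PoincareDGCA F hS.total n where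
  toDGCA := hS.toIsSubfamily.toDGCA
  top i hi := by
    refine eq_bot_iff.2 fun a ha => Subtype.ext ?_
    simpa [P.top i hi] using hS.le _ ha
  fin_cohomology _ := ⟨⊤, inferInstance, fun a _ _ => ⟨a, trivial, 0, by simp⟩⟩
  intg := P.intg ∘ₗ hS.total.val.toLinearMap
  intg_deg i hi a ha := P.intg_deg i hi a (hS.le _ ha)
  intg_d a := P.intg_d a
  nondeg i a ha hda hab := by
    have hda' : P.d (a : A) = 0 := congrArg Subtype.val hda
    obtain ⟨c, hc⟩ := P.nondeg i a (hS.le _ ha) hda' fun b hb hdb => by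
      obtain ⟨c, -, x, hx, rfl⟩ := h.exists_of_cocycle hb hdb
      rw [mul_add, map_add, intg_mul_d_of_cocycle (a := (a : A)) (hS.le _ ha) hda', zero_add]
      exact hab ⟨x, hS.mem_total_of_mem (hS.harmonic_le _ hx)⟩ (hS.harmonic_le _ hx)
        (Subtype.ext (h.harmonic_d hx))
    obtain ⟨c', hc', hac'⟩ := hS.exists_of_exact h ha hc
    exact ⟨⟨c', hS.mem_total_of_mem hc'⟩, Subtype.ext hac'⟩

theorem toPoincare_hodgeType [FiniteDimensional F hS.total] : (hS.toPoincare h).HodgeType := by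
  have hBc : ∀ {k : ℤ} {a : hS.total}, a ∈ (hS.toPoincare h).toDGA.Bc k → (a : A) ∈ P.Bc k := by
    rintro k _ ⟨c, hc, rfl⟩
    exact ⟨c, hS.le _ hc, rfl⟩
  refine ⟨fun k => (H k).comap hS.total.val.toLinearMap,
    fun k => (B k).comap hS.total.val.toLinearMap, fun k => ⟨?_, ?_, ?_⟩, ?_, ?_, ?_, ?_⟩
  · exact fun x hx => ⟨hS.harmonic_le _ hx, Subtype.ext (h.harmonic_d hx)⟩
  · exact Submodule.disjoint_def.2 fun x hx hx' =>
      Subtype.ext (Submodule.disjoint_def.1 (h.1 k).2.1 x (hBc hx) hx')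
  · rintro a ⟨ha, hda⟩
    obtain ⟨c, hc, x, hx, hax⟩ := hS.exists_of_cocycle h ha (congrArg Subtype.val hda)
    exact Submodule.mem_sup.2 ⟨_, ⟨⟨c, hS.mem_total_of_mem hc⟩, hc, rfl⟩,
      ⟨x, hS.mem_total_of_mem (hS.harmonic_le _ hx)⟩, hx, Subtype.ext hax⟩
  · intro k b hb
    have hbk := hS.proj_mem b.2 k
    rwa [DGA.proj_of_mem (a := (b : A)) (h.2.1 k hb)] at hbk
  · refine fun k => Submodule.disjoint_def.2 fun x hx hx' =>
      Subtype.ext (Submodule.disjoint_def.1 (h.2.2.1 k) x ?_ hx')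
    obtain ⟨y, hy, z, hz, rfl⟩ := Submodule.mem_sup.1 hx
    exact add_mem (Submodule.mem_sup_left (hBc hy)) (Submodule.mem_sup_right hz)
  · intro k a ha
    obtain ⟨c, hc, x, hx, b, hb, hab⟩ := hS.exists_decomposition k a ha
    have hc' := hS.mem_total_of_mem hc
    have hx' := hS.mem_total_of_mem (hS.harmonic_le _ hx)
    have hb' : b ∈ hS.total := by
      rw [← eq_sub_iff_add_eq'] at hab
      rw [hab]
      exact sub_mem a.2 (add_mem (hS.d_mem_iSup hc') hx')
    exact Submodule.mem_sup.2 ⟨_, Submodule.mem_sup.2 ⟨_, ⟨⟨c, hc'⟩, hc, rfl⟩, ⟨x, hx'⟩, hx, rfl⟩,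
      ⟨b, hb'⟩, hb, Subtype.ext hab⟩
  · intro j k a ha b hb
    obtain ⟨y, hy, z, hz, rfl⟩ := Submodule.mem_sup.1 ha
    exact h.2.2.2.2 j k _
      (add_mem (Submodule.mem_sup_left hy) (Submodule.mem_sup_right hz)) b hb

theorem inclusion_quasiIso : hS.inclusion.QuasiIso := by
  refine ⟨?_, ?_⟩
  · rintro i a ha - ⟨b, hb⟩
    obtain ⟨c, hc, hac⟩ := hS.exists_of_exact h ha hb
    exact ⟨⟨c, hS.mem_total_of_mem hc⟩, Subtype.ext hac⟩
  · intro i (a : A) ha hda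
    obtain ⟨c, hc, x, hx, rfl⟩ := h.exists_of_cocycle ha hda
    refine ⟨⟨x, hS.mem_total_of_mem (hS.harmonic_le _ hx)⟩, hS.harmonic_le _ hx,
      Subtype.ext (h.harmonic_d hx), -c, ?_⟩
    change x - (P.d c + x) = P.d (-c)
    rw [map_neg]
    abel

end IsHodgeSubfamily

end PoincareDGCA

namespace PoincareDGCA

/-- The homogeneous components of the smallest subalgebra containing `H` and closed under the
operators `f`, where `f k` lowers the degree from `k + 1` to `k`. -/
def smallFamily {F : Type u} {A : Type v} [Field F] [Ring A] [Algebra F A]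
    (H : ℤ → Submodule F A) (f : ℤ → A →ₗ[F] A) (k : ℕ) : Submodule F A :=
  H k ⊔ (⨆ (i : Fin k) (j : Fin k) (_ : (i : ℕ) + j = k),
      smallFamily H f i * smallFamily H f j) ⊔
    (⨆ (i : Fin k) (j : Fin k) (_ : (i : ℕ) + j = k + 1),
      smallFamily H f i * smallFamily H f j).map (f k)
termination_by k
decreasing_by all_goals exact Fin.is_lt _

section smallFamily

variable {F : Type u} {A : Type v} [Field F] [Ring A] [Algebra F A]
  {H : ℤ → Submodule F A} {f : ℤ → A →ₗ[F] A}

theorem smallFamily_le_iff {k : ℕ} {N : Submodule F A} :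
    smallFamily H f k ≤ N ↔ H k ≤ N ∧
      (∀ i j, i < k → j < k → i + j = k → ∀ a ∈ smallFamily H f i, ∀ b ∈ smallFamily H f j,
        a * b ∈ N) ∧
      ∀ i j, i < k → j < k → i + j = k + 1 → ∀ a ∈ smallFamily H f i,
        ∀ b ∈ smallFamily H f j, f k (a * b) ∈ N := by
  rw [smallFamily, sup_le_iff, sup_le_iff, Submodule.map_le_iff_le_comap, and_assoc]
  simp only [iSup_le_iff, Submodule.mul_le, Submodule.mem_comap]
  refine and_congr Iff.rfl (and_congr ?_ ?_)
  · exact ⟨fun h i j hi hj => h ⟨i, hi⟩ ⟨j, hj⟩, fun h i j => h i j i.2 j.2⟩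
  · exact ⟨fun h i j hi hj => h ⟨i, hi⟩ ⟨j, hj⟩, fun h i j => h i j i.2 j.2⟩

theorem harmonic_le_smallFamily (k : ℕ) : H k ≤ smallFamily H f k :=
  (smallFamily_le_iff.1 le_rfl).1

theorem smallFamily_zero : smallFamily H f 0 = H 0 :=
  le_antisymm (smallFamily_le_iff.2 ⟨le_rfl, by omega, by omega⟩) (harmonic_le_smallFamily 0)

theorem smallFamily_fg (hH : ∀ k, (H k).FG) (k : ℕ) : (smallFamily H f k).FG := by
  induction k using Nat.strong_induction_on with
  | _ k ih =>
    rw [smallFamily]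
    refine ((hH k).sup ?_).sup (Submodule.FG.map _ ?_) <;>
    exact Submodule.fg_iSup _ fun i => Submodule.fg_iSup _ fun j => Submodule.fg_iSup _ fun _ =>
      (ih i i.2).mul (ih j j.2)

theorem smallFamily_eq_bot {r : ℤ} (hH : ∀ k : ℤ, 1 ≤ k → k < r → H k = ⊥) {k : ℕ} (hk : 1 ≤ k)
    (hkr : (k : ℤ) < r) : smallFamily H f k = ⊥ := by
  induction k using Nat.strong_induction_on with
  | _ k ih =>
    refine eq_bot_iff.2 (smallFamily_le_iff.2 ⟨(hH k (by omega) hkr).le, ?_, ?_⟩) <;>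
    · intro i j hi hj hij a ha b _
      rw [ih i hi (by omega) (by omega), Submodule.mem_bot] at ha
      simp [ha]

theorem smallFamily_eq_harmonic {r : ℤ} (hH : ∀ k : ℤ, 1 ≤ k → k < r → H k = ⊥) {k : ℕ}
    (hkr : (k : ℤ) ≤ 2 * r - 2) : smallFamily H f k = H k := by
  have hprod : ∀ i j, i < k → j < k → k ≤ i + j → i + j ≤ k + 1 →
      ∀ a ∈ smallFamily H f i, ∀ b ∈ smallFamily H f j, a * b = 0 := by
    intro i j hi hj hij hij' a ha b hb
    rcases lt_or_ge (i : ℤ) r with hir | hir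
    · rw [smallFamily_eq_bot hH (by omega) hir, Submodule.mem_bot] at ha
      rw [ha, zero_mul]
    · rw [smallFamily_eq_bot hH (by omega) (by omega), Submodule.mem_bot] at hb
      rw [hb, mul_zero]
  refine le_antisymm (smallFamily_le_iff.2 ⟨le_rfl, ?_, ?_⟩) (harmonic_le_smallFamily k)
  · intro i j hi hj hij a ha b hb
    simp [hprod i j hi hj (by omega) (by omega) a ha b hb]
  · intro i j hi hj hij a ha b hb
    simp [hprod i j hi hj (by omega) (by omega) a ha b hb]

theorem smallFamily_mul (hH : H 0 ≤ Submodule.span F {1}) {i j : ℕ} {a b : A}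
    (ha : a ∈ smallFamily H f i) (hb : b ∈ smallFamily H f j) :
    a * b ∈ smallFamily H f (i + j) := by
  rcases Nat.eq_zero_or_pos i with rfl | hi
  · rw [smallFamily_zero] at ha
    obtain ⟨c, rfl⟩ := Submodule.mem_span_singleton.1 (hH ha)
    rw [smul_one_mul, zero_add]
    exact Submodule.smul_mem _ c hb
  rcases Nat.eq_zero_or_pos j with rfl | hj
  · rw [smallFamily_zero] at hb
    obtain ⟨c, rfl⟩ := Submodule.mem_span_singleton.1 (hH hb)
    rw [mul_smul_one, add_zero]
    exact Submodule.smul_mem _ c ha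
  exact (smallFamily_le_iff.1 le_rfl).2.1 i j (by omega) (by omega) rfl a ha b hb

end smallFamily

variable {F : Type u} {A : Type v} [Field F] [Ring A] [Algebra F A] {n : ℤ}
  {P : PoincareDGCA F A n} {H B : ℤ → Submodule F A}

namespace IsHodge

variable (h : P.IsHodge H B)
include h

theorem exists_dminus (k : ℤ) : ∃ f : A →ₗ[F] A, (∀ a, f a ∈ B k) ∧
    (∀ b ∈ B k, f (P.d b) = b) ∧ (∀ x ∈ H (k + 1), f x = 0) ∧ ∀ b ∈ B (k + 1), f b = 0 := by
  let g : B k × (H (k + 1) ⊔ B (k + 1) : Submodule F A) →ₗ[F] A :=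
    (P.d ∘ₗ (B k).subtype).coprod (Submodule.subtype _)
  have hg : LinearMap.ker g = ⊥ := by
    refine LinearMap.ker_eq_bot'.2 ?_
    rintro ⟨⟨b, hb⟩, ⟨u, hu⟩⟩ hbu
    change P.d b + u = 0 at hbu
    obtain ⟨x, hx, b', hb', rfl⟩ := Submodule.mem_sup.1 hu
    have hdb : P.d b ∈ P.Bc (k + 1) := ⟨b, by simpa using h.2.1 k hb, rfl⟩
    have hb0 : b' = 0 := by
      refine Submodule.disjoint_def.1 (h.2.2.1 (k + 1)) b' ?_ hb'
      rw [← add_assoc, add_eq_zero_iff_neg_eq] at hbu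
      rw [← hbu]
      exact neg_mem (add_mem (Submodule.mem_sup_left hdb) (Submodule.mem_sup_right hx))
    subst hb0
    rw [add_zero] at hbu
    have hx0 : x = 0 := by
      refine Submodule.disjoint_def.1 (h.1 (k + 1)).2.1 x ?_ hx
      rw [add_eq_zero_iff_neg_eq] at hbu
      rw [← hbu]
      exact neg_mem hdb
    subst hx0
    rw [add_zero] at hbu
    have hb0 : b = 0 := Submodule.disjoint_def.1 (h.2.2.1 k) b ((h.1 k).2.2 ⟨h.2.1 k hb, hbu⟩) hb
    subst hb0
    simp
  obtain ⟨g', hg'⟩ := g.exists_leftInverse_of_injective hg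
  have hg'' : ∀ x, g' (g x) = x := fun x => LinearMap.congr_fun hg' x
  refine ⟨(B k).subtype ∘ₗ LinearMap.fst F _ _ ∘ₗ g', fun a => Subtype.property _, ?_, ?_, ?_⟩
  · intro b hb
    simpa [g] using congrArg (fun y => (y.1 : A)) (hg'' (⟨b, hb⟩, 0))
  · intro x hx
    simpa [g] using congrArg (fun y => (y.1 : A)) (hg'' (0, ⟨x, Submodule.mem_sup_left hx⟩))
  · intro x hx
    simpa [g] using congrArg (fun y => (y.1 : A)) (hg'' (0, ⟨x, Submodule.mem_sup_right hx⟩))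

/-- The component of `d⁻` from degree `k + 1` to degree `k`. -/
noncomputable def dminus (k : ℤ) : A →ₗ[F] A := (h.exists_dminus k).choose

theorem dminus_mem (k : ℤ) (a : A) : h.dminus k a ∈ B k := (h.exists_dminus k).choose_spec.1 a

theorem dminus_d {k : ℤ} {b : A} (hb : b ∈ B k) : h.dminus k (P.d b) = b :=
  (h.exists_dminus k).choose_spec.2.1 b hb

theorem dminus_harmonic {k : ℤ} {x : A} (hx : x ∈ H (k + 1)) : h.dminus k x = 0 :=
  (h.exists_dminus k).choose_spec.2.2.1 x hx

theorem dminus_dminus (k : ℤ) (a : A) : h.dminus k (h.dminus (k + 1) a) = 0 :=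
  (h.exists_dminus k).choose_spec.2.2.2 _ (h.dminus_mem _ a)

theorem dminus_decomposition {k : ℤ} {a : A} (ha : a ∈ P.grading (k + 1)) :
    ∃ x ∈ H (k + 1), ∃ b ∈ B (k + 1), P.d (h.dminus k a) + x + b = a := by
  obtain ⟨c, hc, x, hx, b, hb, rfl⟩ := h.exists_decomposition ha
  rw [add_sub_cancel_right] at hc
  obtain ⟨c', -, y, hy, b', hb', rfl⟩ := h.exists_decomposition hc
  refine ⟨x, hx, b, hb, ?_⟩
  have hb0 : h.dminus k b = 0 := (h.exists_dminus k).choose_spec.2.2.2 b hb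
  simp only [map_add, P.d_d, h.harmonic_d hy, zero_add, h.dminus_d hb', h.dminus_harmonic hx, hb0,
    add_zero]

theorem smallFamily_le_grading (k : ℕ) : smallFamily H h.dminus k ≤ P.grading k := by
  induction k using Nat.strong_induction_on with
  | _ k ih =>
    refine smallFamily_le_iff.2 ⟨fun x hx => h.harmonic_mem hx, ?_, ?_⟩
    · rintro i j hi hj rfl a ha b hb
      simpa using P.mul_mem (ih i hi ha) (ih j hj hb)
    · intro i j _ _ _ a _ b _
      exact h.2.1 k (h.dminus_mem _ _)

section

variable (h1 : H 1 = ⊥)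
include h1

theorem dminus_mem_smallFamily {k : ℕ} {a : A} (ha : a ∈ smallFamily H h.dminus (k + 1)) :
    h.dminus k a ∈ smallFamily H h.dminus k := by
  suffices hle : smallFamily H h.dminus (k + 1) ≤
      (smallFamily H h.dminus k).comap (h.dminus k) from hle ha
  have hbot : smallFamily H h.dminus 1 = ⊥ :=
    smallFamily_eq_bot (r := 2) (fun k hk hk' => by rwa [show k = 1 by omega]) le_rfl (by norm_num)
  refine smallFamily_le_iff.2 ⟨fun x hx => ?_, ?_, ?_⟩
  · rw [Submodule.mem_comap, h.dminus_harmonic (by exact_mod_cast hx)]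
    exact Submodule.zero_mem _
  · intro i j hi hj hij a ha b hb
    rw [Submodule.mem_comap]
    rcases eq_or_ne i 1 with rfl | hi1
    · rw [hbot, Submodule.mem_bot] at ha
      simp [ha]
    rcases eq_or_ne j 1 with rfl | hj1
    · rw [hbot, Submodule.mem_bot] at hb
      simp [hb]
    exact (smallFamily_le_iff.1 le_rfl).2.2 i j (by omega) (by omega) hij a ha b hb
  · intro i j _ _ _ a _ b _
    rw [Submodule.mem_comap, Nat.cast_add, Nat.cast_one, h.dminus_dminus]
    exact Submodule.zero_mem _

variable (h0 : H 0 ≤ Submodule.span F {1})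
include h0

theorem d_mem_smallFamily {k : ℕ} {a : A} (ha : a ∈ smallFamily H h.dminus k) :
    P.d a ∈ smallFamily H h.dminus (k + 1) := by
  induction k using Nat.strong_induction_on generalizing a with
  | _ k ih =>
  have hmul : ∀ i j, i < k → j < k → ∀ a ∈ smallFamily H h.dminus i,
      ∀ b ∈ smallFamily H h.dminus j, P.d (a * b) ∈ smallFamily H h.dminus (i + j + 1) := by
    intro i j hi hj a ha b hb
    rw [P.leibniz a b (h.smallFamily_le_grading i ha)]
    have hab := smallFamily_mul h0 (ih i hi ha) hb
    rw [add_right_comm] at hab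
    exact add_mem hab (Submodule.smul_mem _ _ (smallFamily_mul h0 ha (ih j hj hb) :))
  suffices hle : smallFamily H h.dminus k ≤ (smallFamily H h.dminus (k + 1)).comap P.d from hle ha
  refine smallFamily_le_iff.2 ⟨fun x hx => ?_, ?_, ?_⟩
  · rw [Submodule.mem_comap, h.harmonic_d hx]
    exact Submodule.zero_mem _
  · rintro i j hi hj rfl a ha b hb
    exact hmul i j hi hj a ha b hb
  · intro i j hi hj hij a ha b hb
    have hab := smallFamily_mul h0 ha hb
    have hdab := hmul i j hi hj a ha b hb
    rw [hij] at hab hdab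
    obtain ⟨x, hx, y, hy, hxy⟩ := h.dminus_decomposition (k := k)
      (by exact_mod_cast h.smallFamily_le_grading _ hab)
    have hdy : h.dminus (k + 1 : ℕ) (P.d (a * b)) = y := by
      rw [← hxy, map_add P.d, map_add P.d, P.d_d, h.harmonic_d hx, zero_add, zero_add]
      exact h.dminus_d (by exact_mod_cast hy)
    have hy' := h.dminus_mem_smallFamily h1 hdab
    rw [hdy] at hy'
    rw [Submodule.mem_comap, show P.d (h.dminus k (a * b)) = a * b - x - y by
      rw [eq_sub_iff_add_eq, eq_sub_iff_add_eq, add_right_comm, hxy]]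
    exact sub_mem (sub_mem hab (harmonic_le_smallFamily (k + 1) (by exact_mod_cast hx))) hy'

end

omit h in
/-- Extension of a family of submodules by `⊥` in negative degrees. -/
def extendNeg (S : ℕ → Submodule F A) : ℤ → Submodule F A
  | Int.ofNat k => S k
  | Int.negSucc _ => ⊥

theorem isHodgeSubfamily_smallFamily (h1 : H 1 = ⊥) (h0 : H 0 = Submodule.span F {1}) :
    P.IsHodgeSubfamily H B (extendNeg (smallFamily H h.dminus)) where
  le k := by
    cases k with
    | ofNat k => exact h.smallFamily_le_grading k
    | negSucc k => exact bot_le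
  one := by
    change (1 : A) ∈ smallFamily H h.dminus 0
    rw [smallFamily_zero, h0]
    exact Submodule.mem_span_singleton_self 1
  mul {i j a b} ha hb := by
    cases i with
    | negSucc i => rw [(Submodule.mem_bot F).1 ha, zero_mul]; exact Submodule.zero_mem _
    | ofNat i =>
      cases j with
      | negSucc j => rw [(Submodule.mem_bot F).1 hb, mul_zero]; exact Submodule.zero_mem _
      | ofNat j => exact smallFamily_mul h0.le ha hb
  d {i a} ha := by
    cases i with
    | negSucc i => rw [(Submodule.mem_bot F).1 ha, map_zero]; exact Submodule.zero_mem _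
    | ofNat i => exact h.d_mem_smallFamily h1 h0.le ha
  harmonic_le k := by
    cases k with
    | ofNat k => exact harmonic_le_smallFamily k
    | negSucc k =>
      intro x hx
      have hx' := h.harmonic_mem hx
      rwa [P.nonneg _ (Int.negSucc_lt_zero k)] at hx'
  exists_decomposition k a ha := by
    match k with
    | Int.negSucc k =>
      exact ⟨0, Submodule.zero_mem _, 0, Submodule.zero_mem _, 0, Submodule.zero_mem _, by
        rw [(Submodule.mem_bot F).1 ha, map_zero, add_zero, add_zero]⟩
    | Int.ofNat 0 =>
      change a ∈ smallFamily H h.dminus 0 at ha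
      rw [smallFamily_zero] at ha
      exact ⟨0, Submodule.zero_mem _, a, ha, 0, Submodule.zero_mem _, by simp⟩
    | Int.ofNat (k + 1) =>
      change a ∈ smallFamily H h.dminus (k + 1) at ha
      obtain ⟨x, hx, b, hb, hab⟩ := h.dminus_decomposition (k := k)
        (by exact_mod_cast h.smallFamily_le_grading _ ha)
      refine ⟨h.dminus k a, ?_, x, hx, b, hb, hab⟩
      rw [show Int.ofNat (k + 1) - 1 = Int.ofNat k by simp]
      exact h.dminus_mem_smallFamily h1 ha

theorem harmonic_fg (k : ℤ) : (H k).FG := by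
  obtain ⟨W, hW, hWk⟩ := P.fin_cohomology k
  let q := (LinearMap.range P.d).mkQ
  have hmap : (H k).map q ≤ W.map q := by
    rintro _ ⟨x, hx, rfl⟩
    obtain ⟨w, hw, c, hc⟩ := hWk x (h.harmonic_mem hx) (h.harmonic_d hx)
    refine ⟨w, hw, ((Submodule.Quotient.eq _).2 ?_).symm⟩
    exact ⟨c, hc.symm⟩
  have : FiniteDimensional F (W.map q) := inferInstance
  have : FiniteDimensional F ((H k).map q) := Submodule.finiteDimensional_of_le hmap
  refine Submodule.fg_of_fg_map_of_fg_inf_ker q (Submodule.fg_iff_finiteDimensional _ |>.2 this) ?_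
  convert Submodule.fg_bot
  refine eq_bot_iff.2 ?_
  rintro x ⟨hx, hxd⟩
  rw [SetLike.mem_coe, Submodule.ker_mkQ] at hxd
  obtain ⟨c, rfl⟩ := hxd
  exact Submodule.disjoint_def.1 (h.1 k).2.1 _ (DGA.mem_Bc_of_exact (h.harmonic_mem hx) rfl) hx

theorem harmonic_zero (hconn : P.Connected) : H 0 = Submodule.span F {1} := by
  refine le_antisymm (fun x hx => ?_) ?_
  · obtain ⟨c, rfl⟩ := hconn x (h.harmonic_mem hx) (h.harmonic_d hx)
    exact Submodule.smul_mem _ c (Submodule.mem_span_singleton_self 1)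
  · rw [Submodule.span_singleton_le_iff_mem]
    have hd1 : P.d 1 = 0 := by
      simpa using P.leibniz 1 1 P.one_mem
    obtain ⟨c, hc, x, hx, hx1⟩ := h.exists_of_cocycle P.one_mem hd1
    rw [P.nonneg _ (by norm_num), Submodule.mem_bot] at hc
    rwa [← hx1, hc, map_zero, zero_add]

theorem harmonic_eq_bot {k : ℤ} (hk : ∀ a ∈ P.grading k, P.d a = 0 → P.IsExact a) : H k = ⊥ := by
  refine eq_bot_iff.2 fun x hx => ?_
  obtain ⟨c, hc⟩ := hk x (h.harmonic_mem hx) (h.harmonic_d hx)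
  exact Submodule.disjoint_def.1 (h.1 k).2.1 x (DGA.mem_Bc_of_exact (h.harmonic_mem hx) hc) hx

/-- A highly connected Poincaré DGCA of Hodge type has a finite dimensional subalgebra compatible
with the Hodge type decomposition and with trivial differential in low degrees. -/
theorem exists_small {r : ℤ} (hr : 1 < r) (hconn : P.RConnected (r - 1)) :
    ∃ S : ℤ → Submodule F A, ∃ hS : P.IsHodgeSubfamily H B S,
      FiniteDimensional F hS.total ∧ ∀ k ≤ 2 * r - 2, ∀ a ∈ S k, P.d a = 0 := by
  have hbot : ∀ k : ℤ, 1 ≤ k → k < r → H k = ⊥ := fun k hk hkr =>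
    h.harmonic_eq_bot (hconn.2 k hk (by omega))
  have hS := h.isHodgeSubfamily_smallFamily (hbot 1 le_rfl hr) (h.harmonic_zero hconn.1)
  refine ⟨_, hS, hS.finiteDimensional_total fun k => ?_, fun k hk a ha => ?_⟩
  · cases k with
    | ofNat k => exact smallFamily_fg h.harmonic_fg k
    | negSucc k => exact Submodule.fg_bot
  · cases k with
    | ofNat k =>
      change a ∈ smallFamily H h.dminus k at ha
      rw [smallFamily_eq_harmonic hbot hk] at ha
      exact h.harmonic_d ha
    | negSucc k => rw [(Submodule.mem_bot F).1 ha, map_zero]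

end IsHodge

end PoincareDGCA

/-- An `(r-1)`-connected (`r > 1`) Poincaré DGCA of degree `n` of Hodge
type is equivalent to a finite dimensional nondegenerate Poincaré DGCA `Q*` of degree
`n` whose differential `d : Q^{k-1} → Q^k` can be nonzero only for `2r ≤ k ≤ n-2r+1`.
In particular (1) if `n ≤ 4r-2` then `A*` is formal, and (2) if `n = 4r-1` then
`d : Q^{k-1} → Q^k` vanishes for `k ≠ 2r`. -/
theorem statement_8 {F : Type u} {A : Type v} [Field F] [Ring A] [Algebra F A] {n : ℤ}
    (P : PoincareDGCA F A n) (r : ℤ) (hr : 1 < r)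
    (hconn : P.toDGA.RConnected (r - 1)) (hHodge : P.HodgeType) :
    (∃ (Q : BDGCA.{u, v} F) (PQ : PoincareDGCA F Q.carrier n),
      PQ.toDGCA = Q.str ∧
      FiniteDimensional F Q.carrier ∧
      PQ.perp = ⊥ ∧
      DGCAEquivalent (BDGCA.mk A P.toDGCA) Q ∧
      (∀ k : ℤ, ¬(2 * r ≤ k ∧ k ≤ n - 2 * r + 1) →
        ∀ a ∈ Q.str.grading (k - 1), Q.str.d a = 0) ∧
      (n = 4 * r - 1 → ∀ k : ℤ, k ≠ 2 * r →
        ∀ a ∈ Q.str.grading (k - 1), Q.str.d a = 0)) ∧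
    (n ≤ 4 * r - 2 → DGCAFormal (BDGCA.mk A P.toDGCA)) := by
  obtain ⟨H, B, h⟩ := hHodge
  obtain ⟨S, hS, hfin, hd⟩ := h.exists_small hr hconn
  have hP := hS.toPoincare_hodgeType h
  let P' := hS.toPoincare h
  let Q : BDGCA.{u, v} F := BDGCA.mk (hS.total ⧸ P'.perpIdeal) P'.reducedDGCA
  have hequiv : DGCAEquivalent (BDGCA.mk A P.toDGCA) Q :=
    Relation.EqvGen.trans _ _ _
      (Relation.EqvGen.symm _ _ (Relation.EqvGen.rel _ _ ⟨_, hS.inclusion_quasiIso h⟩))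
      (Relation.EqvGen.rel _ _ ⟨_, PoincareDGCA.reducedHom_quasiIso hP⟩)
  have hlow : ∀ k ≤ 2 * r - 2, ∀ a ∈ P'.grading k, P'.d a = 0 :=
    fun k hk a ha => Subtype.ext (hd k hk a ha)
  have hvanish : ∀ k : ℤ, ¬(2 * r ≤ k ∧ k ≤ n - 2 * r + 1) →
      ∀ a ∈ Q.str.grading (k - 1), Q.str.d a = 0 := by
    intro k hk a ha
    by_cases hk' : 2 * r ≤ k
    · exact PoincareDGCA.reducedDGCA_d_eq_zero (hlow _ (by omega)) ha
    · obtain ⟨b, hb, rfl⟩ := PoincareDGCA.exists_perpMk_eq ha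
      exact (congrArg P'.perpMk (hlow _ (by omega) b hb)).trans (map_zero _)
  refine ⟨⟨Q, PoincareDGCA.reduced hP, rfl, inferInstanceAs (FiniteDimensional F (_ ⧸ _)),
    PoincareDGCA.reduced_perp hP, hequiv, hvanish, fun hn k hk => hvanish k (by omega)⟩,
    fun hn => ⟨Q, LinearMap.ext fun a => ?_, hequiv⟩⟩
  induction a using Q.str.homogeneous_induction_s8 with
  | h k a ha => exact hvanish (k + 1) (by omega) a (by rwa [add_sub_cancel_right])
  | h0 => simp
  | hadd a b ha hb => rw [map_add, ha, hb, map_add]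
end
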